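/- arXiv:2101.11291 — 2 statements merged into one kernel-verified Lean document; each statement's English description precedes it below -/
import Mathlib

section
/- Let 𝔫 be a finite-dimensional Lie algebra over ℚ. The following assertions are equivalent: (i) 𝔫 admits a positive grading over ℚ; (ii) ℂ ⊗_ℚ 𝔫 admits a positive grading; (iii) there exists a Lie algebra automorphism f of 𝔫 such that no eigenvalue of f is an algebraic integer and every eigenvalue of f⁻¹ is an algebraic integer. -/
open TensorProduct

/-- A (ℤ-)grading of a Lie algebra `𝔪` over `K`: a direct sum decomposition
`𝔪 = ⊕_{k ∈ ℤ} 𝔪ₖ` with `⁅𝔪ᵢ, 𝔪ⱼ⁆ ⊆ 𝔪ᵢ₊ⱼ`. -/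
def IsLieGrading (K 𝔪 : Type*) [CommRing K] [LieRing 𝔪] [LieAlgebra K 𝔪]
    (p : ℤ → Submodule K 𝔪) : Prop :=
  DirectSum.IsInternal p ∧
    ∀ (i j : ℤ), ∀ x ∈ p i, ∀ y ∈ p j, ⁅x, y⁆ ∈ p (i + j)

/-- A Lie algebra admits a *special* grading if it has a grading with `𝔪₀ ∩ 𝔷 = 0`,
where `𝔷` is the center. -/
def HasSpecialGrading (K 𝔪 : Type*) [CommRing K] [LieRing 𝔪] [LieAlgebra K 𝔪] : Prop :=
  ∃ p : ℤ → Submodule K 𝔪, IsLieGrading K 𝔪 p ∧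
    p 0 ⊓ (LieAlgebra.center K 𝔪).toSubmodule = ⊥

/-- A Lie algebra admits a *very special* grading if it has a grading with `𝔪₀ = 0`. -/
def HasVerySpecialGrading (K 𝔪 : Type*) [CommRing K] [LieRing 𝔪] [LieAlgebra K 𝔪] : Prop :=
  ∃ p : ℤ → Submodule K 𝔪, IsLieGrading K 𝔪 p ∧ p 0 = ⊥

/-- A Lie algebra admits a *non-negative special* grading if it has a grading with
`𝔪ₖ = 0` for `k < 0` and `𝔪₀ ∩ 𝔷 = 0`. -/
def HasNonnegSpecialGrading (K 𝔪 : Type*) [CommRing K] [LieRing 𝔪] [LieAlgebra K 𝔪] : Prop :=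
  ∃ p : ℤ → Submodule K 𝔪, IsLieGrading K 𝔪 p ∧ (∀ k < 0, p k = ⊥) ∧
    p 0 ⊓ (LieAlgebra.center K 𝔪).toSubmodule = ⊥

/-- A Lie algebra admits a *positive* grading if it has a grading with
`𝔪ₖ = 0` for `k ≤ 0`. -/
def HasPositiveGrading (K 𝔪 : Type*) [CommRing K] [LieRing 𝔪] [LieAlgebra K 𝔪] : Prop :=
  ∃ p : ℤ → Submodule K 𝔪, IsLieGrading K 𝔪 p ∧ ∀ k ≤ 0, p k = ⊥

open Polynomial Module

section Derivation

variable {K 𝔪 : Type*} [CommRing K] [LieRing 𝔪] [LieAlgebra K 𝔪]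

/-- The Leibniz rule for a linear endomorphism of a Lie algebra. -/
def Module.End.IsLieDerivation (X : Module.End K 𝔪) : Prop :=
  ∀ x y : 𝔪, X ⁅x, y⁆ = ⁅X x, y⁆ + ⁅x, X y⁆

/-- An identity between bilinear expressions can be checked on a family of spanning submodules. -/
theorem LinearMap.ext₂_of_iSup_eq_top {ι V W : Type*} [AddCommGroup V] [Module K V]
    [AddCommGroup W] [Module K W] {p : ι → Submodule K V} (hp : ⨆ i, p i = ⊤)
    {B C : V →ₗ[K] V →ₗ[K] W} (h : ∀ i j, ∀ x ∈ p i, ∀ y ∈ p j, B x y = C x y) : B = C := by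
  ext x y
  induction (hp ▸ Submodule.mem_top : x ∈ ⨆ i, p i) using Submodule.iSup_induction' with
  | zero => simp
  | add x₁ x₂ _ _ h₁ h₂ => simp [h₁, h₂]
  | mem i x hx =>
    induction (hp ▸ Submodule.mem_top : y ∈ ⨆ i, p i) using Submodule.iSup_induction' with
    | zero => simp
    | add y₁ y₂ _ _ h₁ h₂ => simp [h₁, h₂]
    | mem j y hy => exact h i j x hx y hy

theorem Module.End.isLieDerivation_of_iSup_eq_top {ι : Type*} {p : ι → Submodule K 𝔪}
    (hp : ⨆ i, p i = ⊤) {X : Module.End K 𝔪}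
    (h : ∀ i j, ∀ x ∈ p i, ∀ y ∈ p j, X ⁅x, y⁆ = ⁅X x, y⁆ + ⁅x, X y⁆) : X.IsLieDerivation := by
  let b : 𝔪 →ₗ[K] 𝔪 →ₗ[K] 𝔪 := LieModule.toEnd K 𝔪 𝔪
  have := LinearMap.ext₂_of_iSup_eq_top hp (B := b.compr₂ X) (C := b.comp X + b.compl₂ X)
    (by simpa [b] using h)
  intro x y
  simpa [b] using LinearMap.congr_fun₂ this x y

/-- A linear endomorphism preserves brackets if it does so on spanning submodules. -/
theorem Module.End.map_lie_of_iSup_eq_top {ι : Type*} {p : ι → Submodule K 𝔪}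
    (hp : ⨆ i, p i = ⊤) {X : Module.End K 𝔪}
    (h : ∀ i j, ∀ x ∈ p i, ∀ y ∈ p j, X ⁅x, y⁆ = ⁅X x, X y⁆) (x y : 𝔪) :
    X ⁅x, y⁆ = ⁅X x, X y⁆ := by
  let b : 𝔪 →ₗ[K] 𝔪 →ₗ[K] 𝔪 := LieModule.toEnd K 𝔪 𝔪
  have := LinearMap.ext₂_of_iSup_eq_top hp (B := b.compr₂ X) (C := b.compl₁₂ X X)
    (by simpa [b] using h)
  simpa [b] using LinearMap.congr_fun₂ this x y

theorem Module.End.IsLieDerivation.smul {X : Module.End K 𝔪} (hX : X.IsLieDerivation) (c : K) :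
    (c • X).IsLieDerivation := fun x y ↦ by simp [hX x y]

end Derivation

section Nodal

variable {K V : Type*} [Field K] [AddCommGroup V] [Module K V]

theorem Module.End.iSup_eigenspace_eq_top_of_aeval_nodal {ι : Type*} {X : Module.End K V}
    {S : Finset ι} {v : ι → K} (hv : Set.InjOn v S) (hX : aeval X (Lagrange.nodal S v) = 0) :
    ⨆ i ∈ S, X.eigenspace (v i) = ⊤ := by
  classical
  rw [eq_top_iff]
  rintro x -
  rcases S.eq_empty_or_nonempty with rfl | hS
  · have : x = 0 := by simpa using LinearMap.congr_fun hX x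
    simp [this]
  have hx : x = ∑ i ∈ S, aeval X (Lagrange.basis S v i) x := by
    rw [← LinearMap.sum_apply, ← map_sum, Lagrange.sum_basis hv hS]
    simp
  rw [hx]
  refine Submodule.sum_mem _ fun i hi ↦ Submodule.mem_iSup_of_mem i <|
    Submodule.mem_iSup_of_mem hi ?_
  have hmul : (Polynomial.X - C (v i)) * Lagrange.basis S v i =
      C (Lagrange.nodalWeight S v i) * Lagrange.nodal S v := by
    rw [Lagrange.basis_eq_prod_sub_inv_mul_nodal_div hi, ← Lagrange.nodal_erase_eq_nodal_div hi,
      Lagrange.nodal_eq_mul_nodal_erase hi]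
    ring
  have := congrArg (fun p ↦ aeval X p x) hmul
  rw [Module.End.mem_eigenspace_iff, ← sub_eq_zero]
  simpa [hX] using this

end Nodal

section Grading

variable {K 𝔪 : Type*} [Field K] [LieRing 𝔪] [LieAlgebra K 𝔪]

/-- A diagonalizable derivation with positive rational eigenvalues yields a positive grading. -/
theorem hasPositiveGrading_of_isLieDerivation [CharZero K] {X : Module.End K 𝔪}
    (hX : X.IsLieDerivation) {S : Finset ℚ} (hS : ∀ s ∈ S, 0 < s)
    (h : aeval X (Lagrange.nodal S fun s ↦ (s : K)) = 0) : HasPositiveGrading K 𝔪 := by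
  have htop := Module.End.iSup_eigenspace_eq_top_of_aeval_nodal
    (Rat.cast_injective.injOn) h
  set M : ℕ := ∏ s ∈ S, s.den with hM
  have hM0 : M ≠ 0 := Finset.prod_ne_zero_iff.mpr fun s _ ↦ s.den_nz
  have key : ∀ s ∈ S, ∃ k : ℤ, (k : ℚ) = M * s := fun s hs ↦ by
    obtain ⟨c, hc⟩ := Finset.dvd_prod_of_mem (fun s : ℚ ↦ s.den) hs
    refine ⟨c * s.num, ?_⟩
    rw [hM, hc]
    push_cast
    rw [mul_comm (s.den : ℚ), mul_assoc, Rat.den_mul_eq_num]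
  have hMK : (M : K) ≠ 0 := Nat.cast_ne_zero.mpr hM0
  have hle (s : ℚ) (hs : s ∈ S) : X.eigenspace s ≤ ⨆ k : ℤ, X.eigenspace (k / M : K) := by
    obtain ⟨k, hk⟩ := key s hs
    refine le_iSup_of_le k (le_of_eq ?_)
    have : (k : K) = M * (s : K) := by exact_mod_cast congrArg (Rat.cast (K := K)) hk
    rw [this, mul_div_cancel_left₀ _ hMK]
  refine ⟨fun k ↦ X.eigenspace (k / M : K), ⟨?_, ?_⟩, ?_⟩
  · rw [DirectSum.isInternal_submodule_iff_iSupIndep_and_iSup_eq_top]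
    refine ⟨X.eigenspaces_iSupIndep.comp (f := fun k : ℤ ↦ (k / M : K)) ?_, ?_⟩
    · intro a b hab
      simpa [div_left_inj' hMK] using hab
    · rw [eq_top_iff, ← htop]
      exact iSup₂_le hle
  · intro i j x hx y hy
    rw [Module.End.mem_eigenspace_iff] at hx hy ⊢
    rw [hX, hx, hy, smul_lie, lie_smul, ← add_smul]
    push_cast
    rw [add_div]
  · intro k hk
    rw [eq_bot_iff]
    intro x hx
    rw [Module.End.mem_eigenspace_iff] at hx
    have h0 := LinearMap.congr_fun h x
    rw [Module.End.aeval_apply_of_mem_apply_eq_smul hx] at h0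
    refine (smul_eq_zero.mp h0).resolve_left ?_
    rw [Lagrange.eval_nodal, ← ne_eq, Finset.prod_ne_zero_iff]
    intro s hs h
    have : ((k / M : ℚ) : K) = s := by push_cast; exact sub_eq_zero.mp h
    have := Rat.cast_injective this
    have h1 := hS s hs
    have h2 : (k / M : ℚ) ≤ 0 :=
      div_nonpos_of_nonpos_of_nonneg (by exact_mod_cast hk) (by positivity)
    linarith

theorem HasPositiveGrading.exists_isLieDerivation [FiniteDimensional K 𝔪]
    (h : HasPositiveGrading K 𝔪) : ∃ (X : Module.End K 𝔪) (S : Finset ℕ), X.IsLieDerivation ∧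
      (∀ s ∈ S, 0 < s) ∧ aeval X (Lagrange.nodal S fun s ↦ (s : K)) = 0 := by
  classical
  obtain ⟨p, ⟨hp, hlie⟩, hpos⟩ := h
  let e := LinearEquiv.ofBijective (DirectSum.coeLinearMap p) hp
  let X : Module.End K 𝔪 := DirectSum.coeLinearMap p ∘ₗ
    DirectSum.lmap (fun k : ℤ ↦ (k : K) • LinearMap.id) ∘ₗ e.symm.toLinearMap
  have hXp (k : ℤ) (x : 𝔪) (hx : x ∈ p k) : X x = (k : K) • x := by
    have : e.symm x = DirectSum.lof K ℤ (fun k ↦ p k) k ⟨x, hx⟩ := by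
      rw [LinearEquiv.symm_apply_eq]
      exact (DirectSum.coeLinearMap_lof p k ⟨x, hx⟩).symm
    simp [X, this]
  have htop := hp.submodule_iSup_eq_top
  have hfin : {k | p k ≠ ⊥}.Finite :=
    WellFoundedGT.finite_ne_bot_of_iSupIndep hp.submodule_iSupIndep
  refine ⟨X, hfin.toFinset.image Int.toNat, ?_, ?_, ?_⟩
  · refine Module.End.isLieDerivation_of_iSup_eq_top htop fun i j x hx y hy ↦ ?_
    rw [hXp _ _ (hlie i j x hx y hy), hXp _ _ hx, hXp _ _ hy]
    simp [add_smul]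
  · intro s hs
    simp only [Finset.mem_image, Set.Finite.mem_toFinset, Set.mem_ofPred_eq] at hs
    obtain ⟨k, hk, rfl⟩ := hs
    by_contra! h
    exact hk (hpos k (by omega))
  · rw [← LinearMap.ker_eq_top, eq_top_iff, ← htop]
    refine iSup_le fun k x hx ↦ ?_
    rw [LinearMap.mem_ker, Module.End.aeval_apply_of_mem_apply_eq_smul (hXp k x hx)]
    rcases eq_or_ne x 0 with rfl | hx0
    · simp
    have hk : p k ≠ ⊥ := fun h ↦ hx0 (by simpa [h] using hx)
    have hk0 : 0 < k := by
      by_contra! h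
      exact hk (hpos k h)
    rw [Lagrange.eval_nodal, Finset.prod_eq_zero (i := k.toNat), zero_smul]
    · exact Finset.mem_image_of_mem _ (by simpa using hk)
    · have : ((k.toNat : ℤ) : K) = k := by rw [Int.toNat_of_nonneg hk0.le]
      rw [← this, Int.cast_natCast, sub_self]

end Grading

section GenEigenspace

variable {K V : Type*} [Field K] [AddCommGroup V] [Module K V]

theorem Module.End.iSup_maxGenEigenspace_eq_top_of_splits {f : Module.End K V} {p : K[X]}
    (hp : p.Splits) (hp0 : p ≠ 0) (hf : aeval f p = 0) : ⨆ μ, f.maxGenEigenspace μ = ⊤ := by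
  classical
  have key (s : Finset K) (n : K → ℕ) :
      LinearMap.ker (aeval f (∏ a ∈ s, (X - C a) ^ n a)) ≤ ⨆ μ, f.maxGenEigenspace μ := by
    induction s using Finset.induction_on with
    | empty => simp [Module.End.one_eq_id]
    | insert a s ha ih =>
      have hco : IsCoprime ((X - C a) ^ n a) (∏ b ∈ s, (X - C b) ^ n b) :=
        IsCoprime.prod_right fun b hb ↦ IsCoprime.pow <|
          isCoprime_X_sub_C_of_isUnit_sub (sub_ne_zero.mpr (ne_of_mem_of_not_mem hb ha).symm).isUnit
      rw [Finset.prod_insert ha, ← sup_ker_aeval_eq_ker_aeval_mul_of_coprime f hco]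
      refine sup_le (fun x hx ↦ Submodule.mem_iSup_of_mem a ?_) ih
      rw [Module.End.mem_maxGenEigenspace]
      exact ⟨n a, by simpa [Algebra.algebraMap_eq_smul_one] using hx⟩
  rw [eq_top_iff]
  refine le_trans ?_ (key p.roots.toFinset fun a ↦ p.roots.count a)
  rintro x -
  have h := congrArg (fun q ↦ aeval f q x) hp.eq_prod_roots
  rw [Finset.prod_multiset_map_count] at h
  simpa [hf, hp0] using h.symm

end GenEigenspace

section LieGenEigenspace

variable {K 𝔪 : Type*} [CommRing K] [LieRing 𝔪] [LieAlgebra K 𝔪] {X : Module.End K 𝔪}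

theorem Module.End.lie_mem_maxGenEigenspace_of_commute {s t : Module.End K (𝔪 ⊗[K] 𝔪)}
    (hst : Commute s t) {x y : 𝔪} {k l : ℕ} (hs : (s ^ k) (x ⊗ₜ y) = 0)
    (ht : (t ^ l) (x ⊗ₜ y) = 0) {ν : K}
    (h : (X - ν • 1) ∘ₗ TensorProduct.lift (LieModule.toEnd K 𝔪 𝔪 : 𝔪 →ₗ[K] 𝔪 →ₗ[K] 𝔪) =
      TensorProduct.lift (LieModule.toEnd K 𝔪 𝔪 : 𝔪 →ₗ[K] 𝔪 →ₗ[K] 𝔪) ∘ₗ (s + t)) :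
    ⁅x, y⁆ ∈ X.maxGenEigenspace ν := by
  rw [Module.End.mem_maxGenEigenspace]
  refine ⟨k + l, ?_⟩
  have h' := LinearMap.congr_fun (Module.End.commute_pow_left_of_commute h (k + l)) (x ⊗ₜ[K] y)
  have hz : ((s + t) ^ (k + l)) (x ⊗ₜ[K] y) = 0 := by
    rw [hst.add_pow', LinearMap.sum_apply]
    refine Finset.sum_eq_zero fun ⟨i, j⟩ hij ↦ ?_
    have hij : i + j = k + l := by simpa using hij
    rw [LinearMap.smul_apply]
    suffices (s ^ i * t ^ j) (x ⊗ₜ[K] y) = 0 by rw [this, smul_zero]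
    rcases (by omega : k ≤ i ∨ l ≤ j) with hi | hj
    · rw [(hst.pow_pow i j).eq, Module.End.mul_apply, Module.End.pow_map_zero_of_le hi hs, map_zero]
    · rw [Module.End.mul_apply, Module.End.pow_map_zero_of_le hj ht, map_zero]
  simpa [hz] using h'

theorem Module.End.IsLieDerivation.lie_mem_maxGenEigenspace (hX : X.IsLieDerivation) {a b : K}
    {x y : 𝔪} (hx : x ∈ X.maxGenEigenspace a) (hy : y ∈ X.maxGenEigenspace b) :
    ⁅x, y⁆ ∈ X.maxGenEigenspace (a + b) := by
  obtain ⟨k, hk⟩ := (Module.End.mem_maxGenEigenspace ..).mp hx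
  obtain ⟨l, hl⟩ := (Module.End.mem_maxGenEigenspace ..).mp hy
  refine Module.End.lie_mem_maxGenEigenspace_of_commute (k := k) (l := l)
    (s := TensorProduct.map (X - a • 1) 1) (t := TensorProduct.map 1 (X - b • 1)) ?_ ?_ ?_ ?_
  · rw [commute_iff_eq, ← TensorProduct.map_mul, ← TensorProduct.map_mul, one_mul, mul_one,
      one_mul, mul_one]
  · rw [TensorProduct.map_pow, TensorProduct.map_tmul, hk, TensorProduct.zero_tmul]
  · rw [TensorProduct.map_pow, TensorProduct.map_tmul, hl, TensorProduct.tmul_zero]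
  · ext v w
    simp [hX v w, add_smul]
    abel

theorem Module.End.lie_mem_maxGenEigenspace_of_map_lie (hX : ∀ x y : 𝔪, X ⁅x, y⁆ = ⁅X x, X y⁆)
    {a b : K} {x y : 𝔪} (hx : x ∈ X.maxGenEigenspace a) (hy : y ∈ X.maxGenEigenspace b) :
    ⁅x, y⁆ ∈ X.maxGenEigenspace (a * b) := by
  obtain ⟨k, hk⟩ := (Module.End.mem_maxGenEigenspace ..).mp hx
  obtain ⟨l, hl⟩ := (Module.End.mem_maxGenEigenspace ..).mp hy
  have hcomm : Commute X (X - b • 1) :=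
    (Commute.refl X).sub_right ((Commute.one_right X).smul_right b)
  refine Module.End.lie_mem_maxGenEigenspace_of_commute (k := k) (l := l)
    (s := TensorProduct.map (X - a • 1) X) (t := TensorProduct.map (a • 1) (X - b • 1)) ?_ ?_ ?_ ?_
  · rw [commute_iff_eq, ← TensorProduct.map_mul, ← TensorProduct.map_mul, hcomm.eq,
      ((Commute.one_right (X - a • 1)).smul_right a).eq]
  · rw [TensorProduct.map_pow, TensorProduct.map_tmul, hk, TensorProduct.zero_tmul]
  · rw [TensorProduct.map_pow, TensorProduct.map_tmul, hl, TensorProduct.tmul_zero]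
  · ext v w
    simp [hX v w, mul_smul, smul_sub]

end LieGenEigenspace

section Semilinear

variable {R R' V V' : Type*} [CommRing R] [CommRing R'] {g : R →+* R'}
  [AddCommGroup V] [Module R V] [AddCommGroup V'] [Module R' V']
  {h : V →ₛₗ[g] V'} {X : Module.End R V} {X' : Module.End R' V'}

theorem LinearMap.semiconj_aeval (hX : ∀ v, h (X v) = X' (h v)) (p : R[X]) (v : V) :
    h (aeval X p v) = aeval X' (p.map g) (h v) := by
  induction p using Polynomial.induction_on generalizing v with
  | C a => simp
  | add p q hp hq => simp [hp, hq]
  | monomial n a ih =>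
    have := ih (X v)
    simp only [Polynomial.map_mul, Polynomial.map_pow, map_C, map_X, map_mul, map_pow, aeval_C,
      aeval_X, Module.End.mul_apply, Module.algebraMap_end_apply, pow_succ, map_smulₛₗ] at this ⊢
    rw [this, hX]

theorem LinearMap.aeval_map_eq_zero_of_semiconj (hX : ∀ v, h (X v) = X' (h v))
    (hspan : Submodule.span R' (Set.range h) = ⊤) {p : R[X]} (hp : aeval X p = 0) :
    aeval X' (p.map g) = 0 := by
  refine LinearMap.ext_on_range hspan fun v ↦ ?_
  rw [← semiconj_aeval hX, hp]
  simp

theorem LinearMap.aeval_eq_zero_of_semiconj (hX : ∀ v, h (X v) = X' (h v))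
    (hinj : Function.Injective h) {p : R[X]} (hp : aeval X' (p.map g) = 0) :
    aeval X p = 0 := by
  ext v
  apply hinj
  rw [semiconj_aeval hX, hp]
  simp

theorem LinearMap.charpoly_eq_map_of_semiconj (hX : ∀ v, h (X v) = X' (h v)) {ι : Type*}
    [Fintype ι] [DecidableEq ι] (b : Basis ι R V) (b' : Basis ι R' V') (hb : ∀ i, h (b i) = b' i)
    [Module.Free R V] [Module.Finite R V] [Module.Free R' V'] [Module.Finite R' V'] :
    X'.charpoly = X.charpoly.map g := by
  have hrepr (v : V) (i : ι) : b'.repr (h v) i = g (b.repr v i) := by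
    have hv : h v = ∑ j, g (b.repr v j) • b' j := by
      rw [← congrArg h (b.sum_repr v), map_sum]
      simp only [map_smulₛₗ, hb]
    rw [hv, b'.repr_sum_self]
  rw [← LinearMap.charpoly_toMatrix X b, ← LinearMap.charpoly_toMatrix X' b',
    ← Matrix.charpoly_map]
  congr 1
  ext i j
  simp [LinearMap.toMatrix_apply, ← hb, ← hX, hrepr]

end Semilinear

section SemilinearLie

variable {R R' 𝔪 𝔪' : Type*} [CommRing R] [CommRing R'] {g : R →+* R'}
  [LieRing 𝔪] [LieAlgebra R 𝔪] [LieRing 𝔪'] [LieAlgebra R' 𝔪']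
  {h : 𝔪 →ₛₗ[g] 𝔪'} {X : Module.End R 𝔪} {X' : Module.End R' 𝔪'}

theorem Module.End.IsLieDerivation.of_semiconj (hlie : ∀ x y, h ⁅x, y⁆ = ⁅h x, h y⁆)
    (hX : ∀ v, h (X v) = X' (h v)) (hinj : Function.Injective h) (hX' : X'.IsLieDerivation) :
    X.IsLieDerivation := fun x y ↦ hinj <| by
  rw [hX, hlie, hX', map_add, hlie, hlie, hX, hX]

theorem Submodule.iSup_span_singleton_range {ι : Type*} {v : ι → 𝔪'}
    (hspan : Submodule.span R' (Set.range v) = ⊤) :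
    ⨆ i, Submodule.span R' {v i} = ⊤ := by
  rw [← Submodule.span_range_eq_iSup, hspan]

theorem Module.End.IsLieDerivation.map_semiconj (hlie : ∀ x y, h ⁅x, y⁆ = ⁅h x, h y⁆)
    (hX : ∀ v, h (X v) = X' (h v)) (hspan : Submodule.span R' (Set.range h) = ⊤)
    (hd : X.IsLieDerivation) : X'.IsLieDerivation := by
  refine Module.End.isLieDerivation_of_iSup_eq_top
    (Submodule.iSup_span_singleton_range hspan) fun i j x hx y hy ↦ ?_
  obtain ⟨a, rfl⟩ := Submodule.mem_span_singleton.mp hx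
  obtain ⟨c, rfl⟩ := Submodule.mem_span_singleton.mp hy
  have := congrArg h (hd i j)
  simp only [hlie, hX, map_add] at this
  simp [this, smul_smul, mul_comm, smul_add]

end SemilinearLie

section BaseChange

variable {R : Type*} (A V : Type*) [CommRing R] [CommRing A] [Algebra R A] [AddCommGroup V]
  [Module R V]

/-- The canonical map from a module to its base change, as a semilinear map. -/
noncomputable def baseChangeUnit : V →ₛₗ[algebraMap R A] A ⊗[R] V where
  toFun x := 1 ⊗ₜ x
  map_add' x y := TensorProduct.tmul_add 1 x y
  map_smul' c x := by rw [TensorProduct.tmul_smul, algebraMap_smul]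

@[simp]
theorem baseChangeUnit_apply (x : V) : baseChangeUnit (R := R) A V x = 1 ⊗ₜ x := rfl

theorem span_range_baseChangeUnit :
    Submodule.span A (Set.range (baseChangeUnit (R := R) A V)) = ⊤ := by
  rw [eq_top_iff]
  rintro x -
  induction x with
  | zero => exact zero_mem _
  | add x y hx hy => exact add_mem hx hy
  | tmul a x =>
    have : a ⊗ₜ[R] x = a • baseChangeUnit (R := R) A V x := by simp [TensorProduct.smul_tmul']
    exact this ▸ Submodule.smul_mem _ _ (Submodule.subset_span ⟨x, rfl⟩)

theorem baseChangeUnit_semiconj (X : Module.End R V) (x : V) :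
    baseChangeUnit (R := R) A V (X x) = X.baseChange A (baseChangeUnit (R := R) A V x) := by
  simp

theorem baseChangeUnit_injective [Module.Free R V] [FaithfulSMul R A] :
    Function.Injective (baseChangeUnit (R := R) A V) := by
  have h := (Module.Flat.rTensor_preserves_injective_linearMap (M := V) (Algebra.linearMap R A)
    (FaithfulSMul.algebraMap_injective R A)).comp (TensorProduct.lid R V).symm.injective
  intro x y hxy
  exact h (by simpa using hxy)

variable (𝔪 : Type*) [LieRing 𝔪] [LieAlgebra R 𝔪]

theorem baseChangeUnit_lie (x y : 𝔪) : baseChangeUnit (R := R) A 𝔪 ⁅x, y⁆ =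
    ⁅baseChangeUnit (R := R) A 𝔪 x, baseChangeUnit (R := R) A 𝔪 y⁆ := by
  simp

variable {𝔪}

theorem Module.End.IsLieDerivation.baseChange {X : Module.End R 𝔪} (hX : X.IsLieDerivation) :
    IsLieDerivation (𝔪 := A ⊗[R] 𝔪) (LinearMap.baseChange A X) :=
  hX.map_semiconj (baseChangeUnit_lie A 𝔪) (baseChangeUnit_semiconj A 𝔪 X)
    (span_range_baseChangeUnit A 𝔪)

theorem Module.End.baseChange_map_lie {X : Module.End R 𝔪} (hX : ∀ x y : 𝔪, X ⁅x, y⁆ = ⁅X x, X y⁆)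
    (x y : A ⊗[R] 𝔪) : X.baseChange A ⁅x, y⁆ = ⁅X.baseChange A x, X.baseChange A y⁆ := by
  refine Module.End.map_lie_of_iSup_eq_top
    (Submodule.iSup_span_singleton_range (span_range_baseChangeUnit (R := R) A 𝔪))
    (fun i j x hx y hy ↦ ?_) x y
  obtain ⟨a, rfl⟩ := Submodule.mem_span_singleton.mp hx
  obtain ⟨c, rfl⟩ := Submodule.mem_span_singleton.mp hy
  simp [hX]

end BaseChange

section Nodal

theorem Lagrange.map_nodal {R R' ι : Type*} [CommRing R] [CommRing R'] (g : R →+* R') (s : Finset ι)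
    (v : ι → R) : (Lagrange.nodal s v).map g = Lagrange.nodal s fun i ↦ g (v i) := by
  simp [Lagrange.nodal, Polynomial.map_prod]

theorem Lagrange.nodal_image {R ι κ : Type*} [CommRing R] [DecidableEq κ] (s : Finset ι)
    {e : ι → κ} (he : Set.InjOn e s) (v : κ → R) :
    Lagrange.nodal (s.image e) v = Lagrange.nodal s fun i ↦ v (e i) :=
  Finset.prod_image he

end Nodal

section GaloisDescent

variable {K L 𝔪 : Type*} [Field K] [Field L] [Algebra K L] [LieRing 𝔪] [LieAlgebra K 𝔪]
  [FiniteDimensional K 𝔪]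

/-- Interpolation of a Galois-invariant function at prescribed multiplicity, with coefficients in
the base field. -/
theorem Polynomial.exists_pow_dvd_sub_C_of_galois_invariant [Normal K L] (s : Finset L) (n : ℕ)
    (ψ : L → K) (hψ : ∀ (σ : Gal(L/K)) x, ψ (σ x) = ψ x) :
    ∃ P : K[X], ∀ a ∈ s, minpoly K a ^ n ∣ P - C (ψ a) := by
  classical
  let T := s.image (minpoly K)
  have hT (q : T) : ∃ a ∈ s, minpoly K a = q := Finset.mem_image.mp q.2
  choose r hr hrq using hT
  obtain ⟨P, hP⟩ := Ideal.exists_forall_sub_mem_ideal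
    (I := fun q : T ↦ Ideal.span {(q : K[X]) ^ n}) (fun p q hpq ↦ by
      have hirr (q : T) : Irreducible (q : K[X]) :=
        hrq q ▸ minpoly.irreducible (Algebra.IsIntegral.isIntegral _)
      have hmonic (q : T) : (q : K[X]).Monic :=
        hrq q ▸ minpoly.monic (Algebra.IsIntegral.isIntegral _)
      rw [Function.onFun, Ideal.isCoprime_span_singleton_iff]
      refine IsCoprime.pow ((hirr p).coprime_iff_not_dvd.mpr fun hdvd ↦ hpq <| Subtype.ext ?_)
      exact eq_of_monic_of_associated (hmonic p) (hmonic q)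
        ((hirr p).associated_of_dvd (hirr q) hdvd)) (fun q ↦ C (ψ (r q)))
  refine ⟨P, fun a ha ↦ ?_⟩
  let q : T := ⟨minpoly K a, Finset.mem_image_of_mem _ ha⟩
  have hq := Ideal.mem_span_singleton.mp (hP q)
  obtain ⟨σ, hσ⟩ := minpoly.exists_algEquiv_of_root (K := K) (x := a) (y := r q)
    (Algebra.IsAlgebraic.isAlgebraic _) (by rw [hrq q]; exact minpoly.aeval K a)
  rwa [← hσ, hψ] at hq

/-- If the generalized eigenspaces of `X`, over an extension `L` splitting its characteristic
polynomial, are graded by a Galois-invariant function `ψ` on `L` that is additive along the Lie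
bracket, then acting by `ψ` on them is a derivation which is a polynomial in `X`. -/
theorem exists_aeval_isLieDerivation [CharZero K] [Normal K L] (X : Module.End K 𝔪)
    (hsplit : (X.charpoly.map (algebraMap K L)).Splits) (ψ : L → ℚ)
    (hψ : ∀ (σ : Gal(L/K)) x, ψ (σ x) = ψ x)
    (hlie : ∀ a ∈ X.charpoly.aroots L, ∀ b ∈ X.charpoly.aroots L, ∃ c, ψ c = ψ a + ψ b ∧
      ∀ x ∈ Module.End.maxGenEigenspace (X.baseChange L) a,
        ∀ y ∈ Module.End.maxGenEigenspace (X.baseChange L) b,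
          ⁅x, y⁆ ∈ Module.End.maxGenEigenspace (X.baseChange L) c) :
    ∃ (P : K[X]) (S : Finset ℚ), (∀ s ∈ S, ∃ a ∈ X.charpoly.aroots L, ψ a = s) ∧
      (aeval X P).IsLieDerivation ∧
      aeval (aeval X P) (Lagrange.nodal S fun s ↦ (s : K)) = 0 := by
  classical
  have : CharZero L := charZero_of_injective_algebraMap (algebraMap K L).injective
  set XL : Module.End L (L ⊗[K] 𝔪) := X.baseChange L
  set n := Module.finrank L (L ⊗[K] 𝔪)
  have hchar : XL.charpoly = X.charpoly.map (algebraMap K L) := LinearMap.charpoly_baseChange ..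
  obtain ⟨P, hP⟩ := Polynomial.exists_pow_dvd_sub_C_of_galois_invariant (K := K)
    (X.charpoly.aroots L).toFinset n (fun a ↦ (ψ a : K)) (fun σ x ↦ by rw [hψ])
  have hbot (a : L) (ha : a ∉ X.charpoly.aroots L) (x) (hx : x ∈ XL.maxGenEigenspace a) :
      x = 0 := by
    by_contra hx0
    have h : XL.HasUnifEigenvalue a ⊤ := fun h ↦ hx0 (by rwa [← Submodule.mem_bot L, ← h])
    have h1 : XL.HasEigenvalue a := h.lt zero_lt_one
    rw [Module.End.hasEigenvalue_iff_isRoot_charpoly, hchar] at h1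
    exact ha (by simpa [X.charpoly_monic.ne_zero, IsRoot] using h1)
  set Y := aeval X P
  have hYL : Y.baseChange L = aeval XL (P.map (algebraMap K L)) :=
    LinearMap.ext_on_range (span_range_baseChangeUnit L 𝔪) fun v ↦ by
      rw [← baseChangeUnit_semiconj, LinearMap.semiconj_aeval (baseChangeUnit_semiconj L 𝔪 X)]
  have hact (a : L) (x) (hx : x ∈ XL.maxGenEigenspace a) :
      Y.baseChange L x = (ψ a : L) • x := by
    by_cases ha : a ∈ X.charpoly.aroots L
    swap
    · simp [hbot a ha x hx]
    have hdvd : (Polynomial.X - C a) ^ n ∣ P.map (algebraMap K L) - C (ψ a : L) := by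
      have h1 := Polynomial.map_dvd (algebraMap K L) (hP a (by simpa using ha))
      rw [Polynomial.map_pow, Polynomial.map_sub, map_C, map_ratCast] at h1
      refine (pow_dvd_pow_of_dvd (dvd_iff_isRoot.mpr ?_) n).trans h1
      rw [IsRoot, eval_map_algebraMap, minpoly.aeval]
    obtain ⟨q, hq⟩ := hdvd
    rw [mul_comm] at hq
    have hx' : ((XL - a • 1) ^ n) x = 0 := by
      rwa [Module.End.maxGenEigenspace_eq_genEigenspace_finrank, Module.End.mem_genEigenspace_nat,
        LinearMap.mem_ker] at hx
    have := congrArg (fun p ↦ aeval XL p x) hq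
    rw [hYL, ← sub_eq_zero]
    simpa [hx', Algebra.algebraMap_eq_smul_one, Module.algebraMap_end_apply] using this
  have htop : ⨆ a, XL.maxGenEigenspace a = ⊤ :=
    Module.End.iSup_maxGenEigenspace_eq_top_of_splits (hchar ▸ hsplit)
      XL.charpoly_monic.ne_zero XL.aeval_self_charpoly
  refine ⟨P, (X.charpoly.aroots L).toFinset.image ψ, fun s hs ↦ ?_, ?_, ?_⟩
  · simpa [and_assoc] using hs
  · refine .of_semiconj (baseChangeUnit_lie L 𝔪) (baseChangeUnit_semiconj L 𝔪 Y)
      (baseChangeUnit_injective L 𝔪) ?_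
    refine Module.End.isLieDerivation_of_iSup_eq_top htop fun a b x hx y hy ↦ ?_
    by_cases ha : a ∈ X.charpoly.aroots L
    swap
    · simp [hbot a ha x hx]
    by_cases hb : b ∈ X.charpoly.aroots L
    swap
    · simp [hbot b hb y hy]
    obtain ⟨c, hc, hxy⟩ := hlie a ha b hb
    rw [hact c _ (hxy x hx y hy), hact a x hx, hact b y hy, hc]
    simp [add_smul]
  · refine LinearMap.aeval_eq_zero_of_semiconj (baseChangeUnit_semiconj L 𝔪 Y)
      (baseChangeUnit_injective L 𝔪) ?_
    rw [Lagrange.map_nodal, ← LinearMap.ker_eq_top, eq_top_iff, ← htop]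
    refine iSup_le fun a x hx ↦ ?_
    rw [LinearMap.mem_ker]
    by_cases ha : a ∈ X.charpoly.aroots L
    swap
    · simp [hbot a ha x hx]
    rw [Module.End.aeval_apply_of_mem_apply_eq_smul (hact a x hx), Lagrange.eval_nodal,
      Finset.prod_eq_zero (Finset.mem_image_of_mem ψ (Multiset.mem_toFinset.mpr ha)) (by simp),
      zero_smul]

end GaloisDescent

section Forward

variable {𝔫 : Type*} [LieRing 𝔫] [LieAlgebra ℚ 𝔫] [FiniteDimensional ℚ 𝔫]

theorem HasPositiveGrading.baseChange (L : Type*) [Field L] [Algebra ℚ L]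
    (h : HasPositiveGrading ℚ 𝔫) : HasPositiveGrading L (L ⊗[ℚ] 𝔫) := by
  obtain ⟨X, S, hX, hS, hXS⟩ := h.exists_isLieDerivation
  have : CharZero L := algebraRat.charZero L
  refine hasPositiveGrading_of_isLieDerivation (hX.baseChange L) (S := S.image Nat.cast)
    (by simpa using hS) ?_
  have := LinearMap.aeval_map_eq_zero_of_semiconj (baseChangeUnit_semiconj L 𝔫 X)
    (span_range_baseChangeUnit L 𝔫) hXS
  rw [Lagrange.map_nodal] at this
  rw [Lagrange.nodal_image _ Nat.cast_injective.injOn]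
  simpa using this

/-- An eigenvalue of the base change of an endomorphism killed by a polynomial with rational roots
is one of these roots. -/
theorem LinearMap.exists_eq_of_hasEigenvalue_baseChange {V : Type*} [AddCommGroup V] [Module ℚ V]
    {L : Type*} [Field L] [Algebra ℚ L] {X : Module.End ℚ V} {ι : Type*} {S : Finset ι} {v : ι → ℚ}
    (h : aeval X (Lagrange.nodal S v) = 0) {μ : L}
    (hμ : Module.End.HasEigenvalue (X.baseChange L) μ) : ∃ i ∈ S, μ = algebraMap ℚ L (v i) := by
  have h0 := LinearMap.aeval_map_eq_zero_of_semiconj (baseChangeUnit_semiconj L V X)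
    (span_range_baseChangeUnit L V) h
  obtain ⟨x, hx⟩ := hμ.exists_hasEigenvector
  have h1 := LinearMap.congr_fun h0 x
  rw [Lagrange.map_nodal, Module.End.aeval_apply_of_mem_apply_eq_smul hx.apply_eq_smul] at h1
  have h2 := (smul_eq_zero.mp h1).resolve_right hx.2
  rw [Lagrange.eval_nodal, Finset.prod_eq_zero_iff] at h2
  exact h2.imp fun i hi ↦ ⟨hi.1, sub_eq_zero.mp hi.2⟩

theorem HasPositiveGrading.exists_lieEquiv (h : HasPositiveGrading ℚ 𝔫) (L : Type*) [Field L]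
    [Algebra ℚ L] : ∃ f : 𝔫 ≃ₗ⁅ℚ⁆ 𝔫,
      (∀ μ : L, Module.End.HasEigenvalue
        (LinearMap.baseChange L f.toLieHom.toLinearMap) μ → ¬ IsIntegral ℤ μ) ∧
      (∀ μ : L, Module.End.HasEigenvalue
        (LinearMap.baseChange L f.symm.toLieHom.toLinearMap) μ → IsIntegral ℤ μ) := by
  obtain ⟨X, S, hX, hS, hXS⟩ := h.exists_isLieDerivation
  have hinj : Set.InjOn (fun s : ℕ ↦ (s : ℚ)) S := Nat.cast_injective.injOn
  have htop : ⨆ s : S, X.eigenspace ((s : ℕ) : ℚ) = ⊤ := by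
    rw [← Module.End.iSup_eigenspace_eq_top_of_aeval_nodal hinj hXS, iSup_subtype']
  let F (t : ℚ) : Module.End ℚ 𝔫 :=
    aeval X (Lagrange.interpolate S (fun s : ℕ ↦ (s : ℚ)) fun s ↦ t ^ s)
  have hF (t : ℚ) (s : ℕ) (x : 𝔫) (hx : x ∈ X.eigenspace s) : F t x = t ^ s • x := by
    rw [Module.End.mem_eigenspace_iff] at hx
    by_cases hs : s ∈ S
    · simp only [F]
      rw [Module.End.aeval_apply_of_mem_apply_eq_smul hx,
        Lagrange.eval_interpolate_at_node _ hinj hs]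
    · have h0 := LinearMap.congr_fun hXS x
      rw [Module.End.aeval_apply_of_mem_apply_eq_smul hx] at h0
      have : x = 0 := by
        refine (smul_eq_zero.mp h0).resolve_left ?_
        rw [Lagrange.eval_nodal, ← ne_eq, Finset.prod_ne_zero_iff]
        intro i hi h
        rw [sub_eq_zero, Nat.cast_inj] at h
        exact hs (h ▸ hi)
      simp [this]
  have hmul (t u : ℚ) (htu : t * u = 1) (x : 𝔫) : F t (F u x) = x := by
    suffices F t ∘ₗ F u = LinearMap.id from LinearMap.congr_fun this x
    rw [← sub_eq_zero, ← LinearMap.ker_eq_top, eq_top_iff, ← htop]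
    refine iSup_le fun s x hx ↦ ?_
    simp [hF _ s x hx, smul_smul, ← mul_pow, mul_comm u, htu]
  have hlie (t : ℚ) (x y : 𝔫) : F t ⁅x, y⁆ = ⁅F t x, F t y⁆ := by
    refine Module.End.map_lie_of_iSup_eq_top htop (fun a b x hx y hy ↦ ?_) x y
    rw [hF t a x hx, hF t b y hy, hF t (a + b : ℕ)]
    · simp [pow_add, smul_smul, mul_comm]
    · rw [Module.End.mem_eigenspace_iff] at hx hy ⊢
      rw [hX, hx, hy]
      simp [add_smul]
  have hnodal (t : ℚ) : aeval (F t) (Lagrange.nodal S fun s ↦ t ^ s) = 0 := by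
    rw [← LinearMap.ker_eq_top, eq_top_iff, ← htop]
    refine iSup_le fun s x hx ↦ ?_
    rw [LinearMap.mem_ker, Module.End.aeval_apply_of_mem_apply_eq_smul (hF t s x hx),
      Lagrange.eval_nodal, Finset.prod_eq_zero s.2 (sub_self _), zero_smul]
  refine ⟨{ F 2⁻¹ with
    map_lie' := hlie _ _ _
    invFun := F 2
    left_inv := hmul _ _ (by norm_num)
    right_inv := hmul _ _ (by norm_num) }, fun μ hμ hint ↦ ?_, fun μ hμ ↦ ?_⟩
  · obtain ⟨s, hs, rfl⟩ := LinearMap.exists_eq_of_hasEigenvalue_baseChange (hnodal 2⁻¹) hμ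
    rw [isIntegral_algebraMap_iff (algebraMap ℚ L).injective] at hint
    obtain ⟨z, hz⟩ := IsIntegrallyClosed.isIntegral_iff.mp hint
    have h1 : (0 : ℚ) < 2⁻¹ ^ s := by positivity
    have h2 : (2⁻¹ : ℚ) ^ s < 1 := pow_lt_one₀ (by norm_num) (by norm_num) (hS s hs).ne'
    rw [← hz, eq_intCast] at h1 h2
    have h1 : 0 < z := by exact_mod_cast h1
    have h2 : z < 1 := by exact_mod_cast h2
    omega
  · obtain ⟨s, hs, rfl⟩ := LinearMap.exists_eq_of_hasEigenvalue_baseChange (hnodal 2) hμ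
    have := isIntegral_algebraMap (R := ℤ) (A := L) (x := 2 ^ s)
    simpa using this

end Forward

section Norm

open ArithmeticFunction.Omega

/-- The number of prime factors of a rational number, those of the denominator being counted
negatively. -/
def Rat.cardFactors (q : ℚ) : ℚ := Ω q.num.natAbs - Ω q.den

theorem Rat.cardFactors_mul {q r : ℚ} (hq : q ≠ 0) (hr : r ≠ 0) :
    (q * r).cardFactors = q.cardFactors + r.cardFactors := by
  have h := congrArg Int.natAbs (Rat.mul_num_den' q r)
  simp only [Int.natAbs_mul, Int.natAbs_natCast] at h
  have h := congrArg Ω h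
  have hqr : q * r ≠ 0 := mul_ne_zero hq hr
  rw [ArithmeticFunction.cardFactors_mul, ArithmeticFunction.cardFactors_mul,
    ArithmeticFunction.cardFactors_mul, ArithmeticFunction.cardFactors_mul] at h
  · have h : (_ : ℚ) = _ := congrArg Nat.cast h
    push_cast at h
    simp only [Rat.cardFactors]
    linarith
  all_goals simp [hq, hr]

/-- The norm of an algebraic integer whose inverse is not integral has prime factors. -/
theorem Algebra.cardFactors_norm_pos {L : Type*} [Field L] [hL : Algebra ℚ L]
    [FiniteDimensional ℚ L] {x : L} (hx0 : x ≠ 0) (hx : IsIntegral ℤ x)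
    (hx' : ¬ IsIntegral ℤ x⁻¹) : 0 < (Algebra.norm ℚ x).cardFactors := by
  have : CharZero L := algebraRat.charZero L
  obtain rfl : hL = DivisionRing.toRatAlgebra := Subsingleton.elim _ _
  have : NumberField L := { to_charZero := inferInstance, to_finiteDimensional := inferInstance }
  let w : NumberField.RingOfIntegers L := ⟨x, hx⟩
  have hw : ((Algebra.norm ℤ w : ℤ) : ℚ) = Algebra.norm ℚ x := Algebra.coe_norm_int w
  have hz0 : Algebra.norm ℤ w ≠ 0 := fun h ↦ hx0 <| by
    simpa [h, Algebra.norm_eq_zero_iff] using hw.symm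
  have hz1 : (Algebra.norm ℤ w).natAbs ≠ 1 := fun h ↦ hx' <| by
    have hu : IsUnit w := by
      rw [NumberField.isUnit_iff_norm, RingOfIntegers.coe_norm]
      change |Algebra.norm ℚ x| = 1
      rw [← hw]
      have : |Algebra.norm ℤ w| = 1 := by rw [Int.abs_eq_natAbs, h, Nat.cast_one]
      exact_mod_cast this
    obtain ⟨v, hv⟩ := hu.exists_right_inv
    have hv' : x * (v : L) = 1 := congrArg (algebraMap (NumberField.RingOfIntegers L) L) hv
    rw [inv_eq_of_mul_eq_one_right hv']
    exact v.2
  rw [← hw, Rat.cardFactors, Rat.num_intCast, Rat.den_intCast, ArithmeticFunction.cardFactors_one,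
    Nat.cast_zero, sub_zero, Nat.cast_pos, ArithmeticFunction.cardFactors_pos_iff_one_lt]
  omega

end Norm

section Automorphism

theorem Polynomial.exists_normal_splits.{u} {K : Type u} [Field K] (p : K[X]) :
    ∃ (L : Type u) (_ : Field L) (_ : Algebra K L), FiniteDimensional K L ∧ Normal K L ∧
      (p.map (algebraMap K L)).Splits :=
  ⟨p.SplittingField, inferInstance, inferInstance, inferInstance, Normal.of_isSplittingField p,
    SplittingField.splits p⟩


variable {𝔫 : Type*} [LieRing 𝔫] [LieAlgebra ℚ 𝔫] [FiniteDimensional ℚ 𝔫]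

theorem hasPositiveGrading_of_lieEquiv {Λ : Type*} [Field Λ] [Algebra ℚ Λ] [IsAlgClosed Λ]
    {f : 𝔫 ≃ₗ⁅ℚ⁆ 𝔫}
    (hf : ∀ μ : Λ, Module.End.HasEigenvalue
      (LinearMap.baseChange Λ f.toLieHom.toLinearMap) μ → ¬ IsIntegral ℤ μ)
    (hf' : ∀ μ : Λ, Module.End.HasEigenvalue
      (LinearMap.baseChange Λ f.symm.toLieHom.toLinearMap) μ → IsIntegral ℤ μ) :
    HasPositiveGrading ℚ 𝔫 := by
  let X : Module.End ℚ 𝔫 := f.toLieHom.toLinearMap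
  let Y : Module.End ℚ 𝔫 := f.symm.toLieHom.toLinearMap
  obtain ⟨L, _, _, _, _, hL⟩ := X.charpoly.exists_normal_splits
  let e : L →ₐ[ℚ] Λ := IsAlgClosed.lift
  have hroot (a : L) (ha : a ∈ X.charpoly.aroots L) :
      a ≠ 0 ∧ ¬ IsIntegral ℤ a ∧ IsIntegral ℤ a⁻¹ := by
    have he : Module.End.HasEigenvalue (X.baseChange Λ) (e a) := by
      rw [Module.End.hasEigenvalue_iff_isRoot_charpoly, LinearMap.charpoly_baseChange, IsRoot,
        eval_map_algebraMap, aeval_algHom_apply, (mem_aroots.mp ha).2, map_zero]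
    obtain ⟨x, hx⟩ := he.exists_hasEigenvector
    have hYX : Y.baseChange Λ (X.baseChange Λ x) = x := by
      rw [← LinearMap.comp_apply, ← LinearMap.baseChange_comp]
      have : Y ∘ₗ X = LinearMap.id := LinearMap.ext fun v ↦ f.symm_apply_apply v
      simp [this]
    rw [hx.apply_eq_smul, map_smul] at hYX
    have hea : e a ≠ 0 := fun h ↦ hx.2 (by rw [← hYX, h, zero_smul])
    have hY : Module.End.HasEigenvalue (Y.baseChange Λ) (e a)⁻¹ := by
      refine Module.End.hasEigenvalue_of_hasEigenvector (x := x) ⟨?_, hx.2⟩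
      rw [Module.End.mem_eigenspace_iff, eq_inv_smul_iff₀ hea, hYX]
    refine ⟨fun h ↦ hea (by rw [h, map_zero]), fun h ↦ hf _ he (h.map (e.restrictScalars ℤ)), ?_⟩
    have := hf' _ hY
    rwa [← map_inv₀, ← AlgHom.coe_restrictScalars' ℤ e,
      isIntegral_algHom_iff (e.restrictScalars ℤ) e.injective] at this
  have hψ {a b : L} (ha : a ∈ X.charpoly.aroots L) (hb : b ∈ X.charpoly.aroots L) :
      (Algebra.norm ℚ (a * b)⁻¹).cardFactors =
        (Algebra.norm ℚ a⁻¹).cardFactors + (Algebra.norm ℚ b⁻¹).cardFactors := by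
    rw [mul_inv, map_mul, Rat.cardFactors_mul] <;>
      simp [Algebra.norm_eq_zero_iff, (hroot a ha).1, (hroot b hb).1]
  obtain ⟨P, S, hS, hd, hn⟩ := exists_aeval_isLieDerivation (L := L) X hL
    (fun a ↦ (Algebra.norm ℚ a⁻¹).cardFactors)
    (fun σ x ↦ by rw [← map_inv₀, Algebra.norm_eq_of_algEquiv]) (fun a ha b hb ↦
      ⟨a * b, hψ ha hb, fun x hx y hy ↦ Module.End.lie_mem_maxGenEigenspace_of_map_lie
        (Module.End.baseChange_map_lie L fun x y ↦ f.toLieHom.map_lie x y) hx hy⟩)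
  refine hasPositiveGrading_of_isLieDerivation hd (fun s hs ↦ ?_) hn
  obtain ⟨a, ha, rfl⟩ := hS s hs
  obtain ⟨h0, h1, h2⟩ := hroot a ha
  exact Algebra.cardFactors_norm_pos (inv_ne_zero h0) h2 (by rwa [inv_inv])

end Automorphism

section IntegralExtension

/-- Homomorphisms to an algebraically closed field extend along integral extensions. -/
theorem IsAlgClosed.exists_comp_algebraMap_eq {A B E : Type*} [CommRing A] [CommRing B]
    [Algebra A B] [Algebra.IsIntegral A B] [FaithfulSMul A B] [Field E] [IsAlgClosed E]
    (π : A →+* E) : ∃ ρ : B →+* E, ∀ a, ρ (algebraMap A B a) = π a := by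
  let p := RingHom.ker π
  have : p.IsPrime := RingHom.ker_isPrime π
  obtain ⟨P, _, _⟩ := Ideal.nonempty_primesOver (S := B) p
  let : Algebra (A ⧸ p) E := (RingHom.kerLift π).toAlgebra
  have : FaithfulSMul (A ⧸ p) E :=
    (faithfulSMul_iff_algebraMap_injective _ _).mpr (RingHom.kerLift_injective π)
  have : Module.IsTorsionFree (A ⧸ p) (B ⧸ P) := FaithfulSMul.to_isTorsionFree _ _
  let f : B ⧸ P →ₐ[A ⧸ p] E := IsAlgClosed.lift
  refine ⟨f.toRingHom.comp (Ideal.Quotient.mk P), fun a ↦ ?_⟩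
  exact f.commutes (Ideal.Quotient.mk p a)

/-- An additive, Galois-invariant function on a finite extension of the fraction field of `A` that
is positive on an integral element as soon as a given functional is positive on all specialisations
of its conjugates. -/
theorem exists_galois_invariant_linearMap {A F L E : Type*} [CommRing A] [IsDomain A] [Algebra ℚ A]
    [Field F] [Algebra A F] [IsFractionRing A F] [Field L] [Algebra F L] [FiniteDimensional F L]
    [Field E] [IsAlgClosed E] [Algebra ℚ E] (π : A →+* E) (r : E →ₗ[ℚ] ℚ) :
    ∃ ψ : L →+ ℚ, (∀ (σ : Gal(L/F)) x, ψ (σ x) = ψ x) ∧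
      ∀ p : A[X], p.Monic → (∀ z ∈ (p.map π).roots, 0 < r z) →
        ∀ a ∈ (p.map (algebraMap A F)).aroots L, 0 < ψ a := by
  classical
  let : Algebra A L := ((algebraMap F L).comp (algebraMap A F)).toAlgebra
  have : IsScalarTower A F L := .of_algebraMap_eq fun _ ↦ rfl
  let : Algebra ℚ L := ((algebraMap A L).comp (algebraMap ℚ A)).toAlgebra
  have : IsScalarTower ℚ A L := .of_algebraMap_eq fun _ ↦ rfl
  have : FaithfulSMul A L := (faithfulSMul_iff_algebraMap_injective _ _).mpr
    ((algebraMap F L).injective.comp (IsFractionRing.injective A F))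
  let B := integralClosure A L
  obtain ⟨ρ, hρ⟩ := IsAlgClosed.exists_comp_algebraMap_eq (B := B) π
  let V : Submodule ℚ L := B.toSubmodule.restrictScalars ℚ
  let rρ : V →ₗ[ℚ] ℚ := (r.toAddMonoidHom.comp ρ.toAddMonoidHom : B →+ ℚ).toRatLinearMap
  obtain ⟨φ, hφ⟩ := LinearMap.exists_extend rρ
  refine ⟨∑ σ : Gal(L/F), φ.toAddMonoidHom.comp (σ : L →+ L), fun σ x ↦ ?_,
    fun p hp hr a ha ↦ ?_⟩
  · simp only [AddMonoidHom.finsetSum_apply]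
    exact Fintype.sum_equiv (Equiv.mulRight σ) _ _ fun τ ↦ rfl
  · simp only [AddMonoidHom.finsetSum_apply]
    refine Finset.sum_pos (fun σ _ ↦ ?_) Finset.univ_nonempty
    have hσ : aeval (σ a) p = 0 := by
      have := (mem_aroots.mp ha).2
      rw [aeval_map_algebraMap] at this
      have h := aeval_algHom_apply ((σ : L →ₐ[F] L).restrictScalars A) a p
      rwa [this, map_zero] at h
    let b : B := ⟨σ a, p, hp, hσ⟩
    have h1 : φ (σ a) = r (ρ b) := LinearMap.congr_fun hφ b
    change 0 < φ (σ a)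
    rw [h1]
    refine hr _ ((mem_roots (hp.map π).ne_zero).mpr ?_)
    have h2 : aeval b p = 0 := Subtype.ext ((aeval_algHom_apply B.val b p).symm.trans hσ)
    have h3 := congrArg ρ h2
    rw [aeval_def, hom_eval₂, map_zero] at h3
    have h4 : ρ.comp (algebraMap A B) = π := RingHom.ext hρ
    rwa [IsRoot, eval_map, ← h4]

end IntegralExtension

section Transfer

variable {k R R' R'' V : Type*} [Field k] [CommRing R] [CommRing R'] [CommRing R''] [Algebra k R]
  [Algebra k R'] [Algebra k R''] [AddCommGroup V] [Module k V]

/-- The endomorphism of `R' ⊗ V` obtained from one of `R ⊗ V` by applying a `k`-linear map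
`t : R → R'` to its matrix coefficients over `k`. -/
noncomputable def Module.End.transfer (t : R →ₗ[k] R') (X : Module.End R (R ⊗[k] V)) :
    Module.End R' (R' ⊗[k] V) :=
  LinearMap.liftBaseChange R' (t.rTensor V ∘ₗ X.restrictScalars k ∘ₗ TensorProduct.mk k R V 1)

@[simp]
theorem Module.End.transfer_one_tmul (t : R →ₗ[k] R') (X : Module.End R (R ⊗[k] V)) (v : V) :
    X.transfer t (1 ⊗ₜ v) = t.rTensor V (X (1 ⊗ₜ v)) := by
  simp [transfer]

theorem Module.End.ext_one_tmul {X Y : Module.End R (R ⊗[k] V)}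
    (h : ∀ v : V, X (1 ⊗ₜ v) = Y (1 ⊗ₜ v)) : X = Y :=
  LinearMap.ext_on_range (span_range_baseChangeUnit R V) h

theorem Module.End.transfer_transfer (t : R →ₗ[k] R') (t' : R' →ₗ[k] R'')
    (X : Module.End R (R ⊗[k] V)) : (X.transfer t).transfer t' = X.transfer (t' ∘ₗ t) :=
  ext_one_tmul fun v ↦ by simp [LinearMap.rTensor_comp]

theorem Module.End.transfer_id (X : Module.End R (R ⊗[k] V)) : X.transfer LinearMap.id = X :=
  ext_one_tmul fun v ↦ by simp

variable (V) in
/-- Change of coefficients along an algebra homomorphism, as a semilinear map. -/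
noncomputable def AlgHom.semilinearRTensor (g : R →ₐ[k] R') :
    R ⊗[k] V →ₛₗ[(g : R →+* R')] R' ⊗[k] V where
  toFun := g.toLinearMap.rTensor V
  map_add' := map_add _
  map_smul' c x := by
    induction x with
    | zero => simp
    | add x y hx hy => simp only [smul_add, map_add, hx, hy]
    | tmul a v => simp [TensorProduct.smul_tmul']

@[simp]
theorem AlgHom.semilinearRTensor_tmul (g : R →ₐ[k] R') (a : R) (v : V) :
    g.semilinearRTensor V (a ⊗ₜ v) = g a ⊗ₜ v := rfl

theorem AlgHom.semilinearRTensor_injective {g : R →ₐ[k] R'} (hg : Function.Injective g) :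
    Function.Injective (g.semilinearRTensor V) :=
  Module.Flat.rTensor_preserves_injective_linearMap (M := V) g.toLinearMap hg

theorem AlgHom.span_range_semilinearRTensor (g : R →ₐ[k] R') :
    Submodule.span R' (Set.range (g.semilinearRTensor V)) = ⊤ := by
  rw [eq_top_iff, ← span_range_baseChangeUnit (R := k) R' V]
  refine Submodule.span_mono ?_
  rintro _ ⟨v, rfl⟩
  exact ⟨1 ⊗ₜ v, by simp⟩

theorem AlgHom.semilinearRTensor_semiconj (g : R →ₐ[k] R') (X : Module.End R (R ⊗[k] V))
    (x : R ⊗[k] V) : g.semilinearRTensor V (X x) =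
      X.transfer g.toLinearMap (g.semilinearRTensor V x) := by
  induction x with
  | zero => simp
  | add x y hx hy => simp only [map_add, hx, hy]
  | tmul a v =>
    have h1 : a ⊗ₜ[k] v = a • (1 ⊗ₜ[k] v : R ⊗[k] V) := by simp [TensorProduct.smul_tmul']
    rw [h1]
    simp only [map_smulₛₗ, semilinearRTensor_tmul, map_one, Module.End.transfer_one_tmul]
    rfl

theorem Module.End.charpoly_transfer [FiniteDimensional k V] (g : R →ₐ[k] R')
    (X : Module.End R (R ⊗[k] V)) :
    (X.transfer g.toLinearMap).charpoly = X.charpoly.map (g : R →+* R') :=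
  LinearMap.charpoly_eq_map_of_semiconj (g.semilinearRTensor_semiconj X)
    ((Module.finBasis k V).baseChange R) ((Module.finBasis k V).baseChange R') (by simp)

variable {𝔫 : Type*} [LieRing 𝔫] [LieAlgebra k 𝔫]

theorem AlgHom.semilinearRTensor_lie (g : R →ₐ[k] R') (x y : R ⊗[k] 𝔫) :
    g.semilinearRTensor 𝔫 ⁅x, y⁆ = ⁅g.semilinearRTensor 𝔫 x, g.semilinearRTensor 𝔫 y⁆ := by
  induction x with
  | zero => simp
  | add x x' hx hx' => simp only [map_add, add_lie, hx, hx']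
  | tmul a v =>
    induction y with
    | zero => simp
    | add y y' hy hy' => simp only [map_add, lie_add, hy, hy']
    | tmul c w => simp

theorem LinearMap.rTensor_lie_one_tmul (t : R →ₗ[k] R') (x : R ⊗[k] 𝔫) (w : 𝔫) :
    t.rTensor 𝔫 ⁅x, (1 : R) ⊗ₜ[k] w⁆ = ⁅t.rTensor 𝔫 x, (1 : R') ⊗ₜ[k] w⁆ := by
  induction x with
  | zero => simp
  | add x y hx hy => simp only [map_add, add_lie, hx, hy]
  | tmul a v => simp

theorem Module.End.IsLieDerivation.transfer (t : R →ₗ[k] R') {X : Module.End R (R ⊗[k] 𝔫)}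
    (hX : X.IsLieDerivation) : IsLieDerivation (𝔪 := R' ⊗[k] 𝔫) (X.transfer t) := by
  refine Module.End.isLieDerivation_of_iSup_eq_top
    (Submodule.iSup_span_singleton_range (span_range_baseChangeUnit (R := k) R' 𝔫))
    fun v w x hx y hy ↦ ?_
  obtain ⟨a, rfl⟩ := Submodule.mem_span_singleton.mp hx
  obtain ⟨c, rfl⟩ := Submodule.mem_span_singleton.mp hy
  have h : X.transfer t ⁅(1 : R') ⊗ₜ[k] v, (1 : R') ⊗ₜ[k] w⁆ =
      ⁅X.transfer t (1 ⊗ₜ v), (1 : R') ⊗ₜ[k] w⁆ + ⁅(1 : R') ⊗ₜ[k] v, X.transfer t (1 ⊗ₜ w)⁆ := by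
    have h1 := hX (1 ⊗ₜ v) (1 ⊗ₜ w)
    rw [← lie_skew (1 ⊗ₜ v) (X (1 ⊗ₜ w))] at h1
    have h2 := congrArg (t.rTensor 𝔫) h1
    rw [map_add, map_neg, LinearMap.rTensor_lie_one_tmul, LinearMap.rTensor_lie_one_tmul] at h2
    rw [← lie_skew (1 ⊗ₜ v) (X.transfer t _)]
    simpa using h2
  simp only [baseChangeUnit_apply, map_smul, smul_lie, lie_smul, h, smul_add]

end Transfer

section Descent

theorem Lagrange.aeval_smul_nodal_eq_zero {K R ι : Type*} [CommRing K] [Ring R] [Algebra K R]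
    {x : R} {S : Finset ι} {v : ι → K} (h : aeval x (Lagrange.nodal S v) = 0) (c : K) :
    aeval (c • x) (Lagrange.nodal S fun i ↦ c * v i) = 0 := by
  classical
  suffices aeval (c • x) (Lagrange.nodal S fun i ↦ c * v i) =
      c ^ S.card • aeval x (Lagrange.nodal S v) by rw [this, h, smul_zero]
  clear h
  induction S using Finset.induction_on with
  | empty => simp
  | insert a S ha ih =>
    have hX : aeval (c • x) (X - C (c * v a)) = c • aeval x (X - C (v a)) := by
      simp [Algebra.algebraMap_eq_smul_one, smul_sub, smul_comm c]
    rw [Lagrange.nodal_insert_eq_nodal ha, Lagrange.nodal_insert_eq_nodal ha,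
      map_mul (aeval (c • x)), ih, hX, smul_mul_smul_comm, ← map_mul,
      Finset.card_insert_of_notMem ha, pow_succ']

variable {𝔫 : Type*} [LieRing 𝔫] [LieAlgebra ℚ 𝔫] [FiniteDimensional ℚ 𝔫]

/-- A derivation over a domain `A` one of whose specialisations to an algebraically closed field
has positive eigenvalues has a polynomial expression that is, up to a denominator, a diagonalizable
derivation with positive rational eigenvalues. -/
theorem exists_aeval_isLieDerivation_of_specialization {A : Type*} (F : Type*) {E : Type*}
    [CommRing A] [IsDomain A] [Algebra ℚ A] [Field F] [Algebra A F] [IsFractionRing A F]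
    [Algebra ℚ F] [IsScalarTower ℚ A F] [Field E] [IsAlgClosed E] [Algebra ℚ E]
    {Y : Module.End A (A ⊗[ℚ] 𝔫)} (hY : Y.IsLieDerivation) (π : A →ₐ[ℚ] E) (r : E →ₗ[ℚ] ℚ)
    (hr : ∀ z ∈ (Y.transfer π.toLinearMap).charpoly.roots, 0 < r z) :
    ∃ (Q : A[X]) (d : A) (S : Finset ℚ), d ≠ 0 ∧ (∀ s ∈ S, 0 < s) ∧
      (aeval Y Q).IsLieDerivation ∧
        aeval (aeval Y Q) (Lagrange.nodal S fun s ↦ d * algebraMap ℚ A s) = 0 := by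
  have : CharZero F := algebraRat.charZero F
  let g : A →ₐ[ℚ] F := IsScalarTower.toAlgHom ℚ A F
  have hg : (g : A →+* F) = algebraMap A F := rfl
  let X : Module.End F (F ⊗[ℚ] 𝔫) := Y.transfer g.toLinearMap
  have hX : X.IsLieDerivation := hY.transfer _
  have hXc : X.charpoly = Y.charpoly.map (algebraMap A F) := Module.End.charpoly_transfer g Y
  obtain ⟨L, _, _, _, _, hL⟩ := X.charpoly.exists_normal_splits
  obtain ⟨ψ, hψ, hpos⟩ := exists_galois_invariant_linearMap (F := F) (L := L) (π : A →+* E) r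
  obtain ⟨P, S, hS, hd, hn⟩ := exists_aeval_isLieDerivation X hL ψ hψ fun a _ b _ ↦
    ⟨a + b, map_add ψ a b, fun x hx y hy ↦ (hX.baseChange L).lie_mem_maxGenEigenspace hx hy⟩
  obtain ⟨d, hd0, hdP⟩ := IsLocalization.integerNormalization_spec (nonZeroDivisors A) P
  set Q := IsLocalization.integerNormalization (nonZeroDivisors A) P
  have hQ : aeval X (Q.map (g : A →+* F)) = algebraMap A F d • aeval X P := by
    rw [hg, hdP, ← IsScalarTower.algebraMap_smul F d P, map_smul]
  have hconj := LinearMap.semiconj_aeval (g.semilinearRTensor_semiconj Y) Q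
  have hinj := g.semilinearRTensor_injective (V := 𝔫) (IsFractionRing.injective A F)
  refine ⟨Q, d, S, nonZeroDivisors.ne_zero hd0, fun s hs ↦ ?_,
    .of_semiconj g.semilinearRTensor_lie hconj hinj ?_,
    LinearMap.aeval_eq_zero_of_semiconj hconj hinj ?_⟩
  · obtain ⟨a, ha, rfl⟩ := hS s hs
    rw [hXc] at ha
    refine hpos _ Y.charpoly_monic ?_ a ha
    rwa [← Module.End.charpoly_transfer]
  · exact hQ ▸ hd.smul _
  · change aeval (aeval X (Q.map (g : A →+* F))) _ = 0
    rw [hQ, Lagrange.map_nodal]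
    have := Lagrange.aeval_smul_nodal_eq_zero hn (algebraMap A F d)
    simpa [hg, ← IsScalarTower.algebraMap_apply] using this

theorem HasPositiveGrading.of_baseChange {E : Type*} [Field E] [IsAlgClosed E] [Algebra ℚ E]
    (h : HasPositiveGrading E (E ⊗[ℚ] 𝔫)) : HasPositiveGrading ℚ 𝔫 := by
  obtain ⟨δ, S₀, hδ, hS₀, hn₀⟩ := h.exists_isLieDerivation
  have : CharZero E := algebraRat.charZero E
  let c := Basis.ofVectorSpace ℚ E
  let A := MvPolynomial (Basis.ofVectorSpaceIndex ℚ E) ℚ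
  let s : E →ₗ[ℚ] A := c.constr ℚ MvPolynomial.X
  let π : A →ₐ[ℚ] E := MvPolynomial.aeval c
  have hπs : π.toLinearMap ∘ₗ s = LinearMap.id := c.ext fun i ↦ by
    simp only [LinearMap.comp_apply, s, Basis.constr_basis]
    exact MvPolynomial.aeval_X (R := ℚ) c i
  have hδA : (δ.transfer s).transfer π.toLinearMap = δ := by
    rw [Module.End.transfer_transfer, hπs, Module.End.transfer_id]
  obtain ⟨r, hr⟩ := (LinearMap.toSpanSingleton ℚ E 1).exists_leftInverse_of_injective
    (LinearMap.ker_toSpanSingleton ℚ one_ne_zero)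
  have hr1 (m : ℚ) : r (m : E) = m := by
    simpa [Algebra.smul_def] using LinearMap.congr_fun hr m
  obtain ⟨Q, d, S, hd, hS, hder, hn⟩ := exists_aeval_isLieDerivation_of_specialization
    (FractionRing A) (hδ.transfer s) π r (fun z hz ↦ by
      rw [hδA] at hz
      have hz := (Module.End.hasEigenvalue_iff_isRoot_charpoly _ _).mpr
        (isRoot_of_mem_roots hz)
      obtain ⟨x, hx⟩ := hz.exists_hasEigenvector
      have h1 := LinearMap.congr_fun hn₀ x
      rw [Module.End.aeval_apply_of_mem_apply_eq_smul hx.apply_eq_smul] at h1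
      have h2 := (smul_eq_zero.mp h1).resolve_right hx.2
      rw [Lagrange.eval_nodal, Finset.prod_eq_zero_iff] at h2
      obtain ⟨i, hi, hzi⟩ := h2
      rw [sub_eq_zero.mp hzi, ← Rat.cast_natCast, hr1, Nat.cast_pos]
      exact hS₀ i hi)
  obtain ⟨a, ha⟩ : ∃ a, MvPolynomial.eval a d ≠ 0 := by
    by_contra! h
    exact hd (MvPolynomial.funext (by simpa using h))
  let ev : A →ₐ[ℚ] ℚ := MvPolynomial.aeval a
  have hev : ev d ≠ 0 := by rwa [← MvPolynomial.coe_aeval_eq_eval] at ha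
  set Y := aeval (δ.transfer s) Q
  let Z : Module.End ℚ (ℚ ⊗[ℚ] 𝔫) := Y.transfer ev.toLinearMap
  have hZ : aeval Z (Lagrange.nodal S fun s ↦ ev d * s) = 0 := by
    have := LinearMap.aeval_map_eq_zero_of_semiconj (ev.semilinearRTensor_semiconj Y)
      ev.span_range_semilinearRTensor hn
    rw [Lagrange.map_nodal] at this
    simpa using this
  have hZ' := Lagrange.aeval_smul_nodal_eq_zero hZ (ev d)⁻¹
  simp only [inv_mul_cancel_left₀ hev] at hZ'
  let e := TensorProduct.lid ℚ 𝔫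
  let T : Module.End ℚ 𝔫 := e ∘ₗ ((ev d)⁻¹ • Z) ∘ₗ e.symm
  have hT (v : 𝔫) : baseChangeUnit (R := ℚ) ℚ 𝔫 (T v) =
      ((ev d)⁻¹ • Z) (baseChangeUnit (R := ℚ) ℚ 𝔫 v) :=
    e.symm_apply_apply _
  refine hasPositiveGrading_of_isLieDerivation (X := T) (.of_semiconj (baseChangeUnit_lie ℚ 𝔫) hT
    (baseChangeUnit_injective ℚ 𝔫) ((hder.transfer _).smul _)) hS
    (LinearMap.aeval_eq_zero_of_semiconj hT (baseChangeUnit_injective ℚ 𝔫) ?_)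
  rw [Lagrange.map_nodal]
  simpa using hZ'

end Descent

/-- For a finite-dimensional Lie algebra `𝔫` over `ℚ`, the following
are equivalent: (i) `𝔫` admits a positive grading over `ℚ`; (ii) `ℂ ⊗ 𝔫` admits a
positive grading; (iii) there is a Lie algebra automorphism `f` of `𝔫` such that no
eigenvalue of `f` is an algebraic integer, while every eigenvalue of `f⁻¹` is an
algebraic integer. -/
theorem hasPositiveGrading_tfae
    {𝔫 : Type*} [LieRing 𝔫] [LieAlgebra ℚ 𝔫] [FiniteDimensional ℚ 𝔫] :
    (HasPositiveGrading ℚ 𝔫 ↔ HasPositiveGrading ℂ (ℂ ⊗[ℚ] 𝔫)) ∧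
    (HasPositiveGrading ℂ (ℂ ⊗[ℚ] 𝔫) ↔
      ∃ f : 𝔫 ≃ₗ⁅ℚ⁆ 𝔫,
        (∀ μ : AlgebraicClosure ℚ,
          Module.End.HasEigenvalue
            (LinearMap.baseChange (AlgebraicClosure ℚ) f.toLieHom.toLinearMap) μ →
          ¬ IsIntegral ℤ μ) ∧
        (∀ μ : AlgebraicClosure ℚ,
          Module.End.HasEigenvalue
            (LinearMap.baseChange (AlgebraicClosure ℚ) f.symm.toLieHom.toLinearMap) μ →
          IsIntegral ℤ μ)) := by
  exact ⟨⟨fun h ↦ h.baseChange ℂ, .of_baseChange⟩, fun h ↦ h.of_baseChange.exists_lieEquiv _,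
    fun ⟨_, hf, hf'⟩ ↦ (hasPositiveGrading_of_lieEquiv hf hf').baseChange ℂ⟩
end

section
/- Let d be a positive square-free integer, K = ℚ(√−d), 𝒪_K its ring of integers, and let 𝒥 be the set of nonzero proper ideals π of 𝒪_K such that π and its complex conjugate π̄ are coprime (π + π̄ = 𝒪_K) and π² is a principal ideal. Then F(d) = min over π ∈ 𝒥 of the absolute norm N_{K/ℚ}(π) = Card(𝒪_K/π). In particular, F(1) = 5 and F(3) = 7. -/
set_option synthInstance.maxHeartbeats 400000
set_option maxHeartbeats 1000000

open NumberField

/-- For `z ∈ K^×`, the ideal `π_z = {x ∈ 𝒪_K | xz ∈ 𝒪_K}` of the ring of integers of a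
number field `K` (`xz ∈ 𝒪_K` being expressed as `xz` integral over `ℤ`). -/
noncomputable def zIdeal (K : Type*) [Field K] [NumberField K] (z : K) :
    Ideal (𝓞 K) where
  carrier := {x | IsIntegral ℤ ((algebraMap (𝓞 K) K x) * z)}
  zero_mem' := by
    simp only [Set.mem_setOf_eq, map_zero, zero_mul]
    exact isIntegral_zero
  add_mem' := by
    intro a b ha hb
    simp only [Set.mem_setOf_eq, map_add, add_mul] at *
    exact ha.add hb
  smul_mem' := by
    intro c x hx
    simp only [Set.mem_setOf_eq, smul_eq_mul, map_mul, mul_assoc] at *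
    exact (RingOfIntegers.isIntegral_coe c).mul hx

/-- `F(d) = min_{z ∈ K₁ \ R} d(z)` where `K₁` is the group of norm-one elements of the
imaginary quadratic field `K = ℚ(√-d)` (the nontrivial element of `Gal(K/ℚ)` being `σ`),
`R` the roots of unity of `K`, and `d(z) = Card(𝒪_K/π_z)`. -/
noncomputable def Fquad (K : Type*) [Field K] [NumberField K] (σ : K ≃ₐ[ℚ] K) : ℕ :=
  sInf {m : ℕ | ∃ z : K, z * σ z = 1 ∧ (¬ ∃ k : ℕ, 0 < k ∧ z ^ k = 1) ∧
    m = Nat.card ((𝓞 K) ⧸ zIdeal K z)}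

lemma isIntegral_of_pow_eq_one {K : Type*} [Field K] {z : K} {k : ℕ} (hk : 0 < k) (h : z ^ k = 1) :
    IsIntegral ℤ z :=
  IsIntegral.of_pow hk (h ▸ isIntegral_one)

lemma exists_pow_eq_one_of_sq_le_four {K : Type*} [Field K] {z : K} {t : ℤ} (ht : t ^ 2 ≤ 4)
    (hz : z ^ 2 - t * z + 1 = 0) :
    ∃ k : ℕ, 0 < k ∧ z ^ k = 1 := by
  have h1 : -2 ≤ t := by nlinarith
  have h2 : t ≤ 2 := by nlinarith
  refine ⟨12, by norm_num, ?_⟩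
  interval_cases t <;> push_cast at hz
  · have h : z = -1 := by
      have h : (z + 1) ^ 2 = 0 := by linear_combination hz
      linear_combination pow_eq_zero_iff (two_ne_zero) |>.1 h
    rw [h]
    norm_num
  · have h : z ^ 3 = 1 := by linear_combination (z - 1) * hz
    linear_combination (z ^ 9 + z ^ 6 + z ^ 3 + 1) * h
  · have h : z ^ 2 = -1 := by linear_combination hz
    linear_combination (z ^ 10 - z ^ 8 + z ^ 6 - z ^ 4 + z ^ 2 - 1) * h
  · have h : z ^ 3 = -1 := by linear_combination (z + 1) * hz
    linear_combination (z ^ 9 - z ^ 6 + z ^ 3 - 1) * h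
  · have h : z = 1 := by
      have h : (z - 1) ^ 2 = 0 := by linear_combination hz
      linear_combination pow_eq_zero_iff (two_ne_zero) |>.1 h
    rw [h]
    norm_num

lemma int_dvd_of_sq_add_sq {n : ℕ} (hn0 : 0 < n) (hn : n < 5) {a c : ℤ}
    (h : 4 * (n : ℤ) ^ 2 = a ^ 2 + c ^ 2) : (n : ℤ) ∣ a := by
  have h1 : a ≤ 2 * n := by nlinarith [sq_nonneg c]
  have h2 : -(2 * n) ≤ a := by nlinarith [sq_nonneg c]
  have h3 : c ≤ 2 * n := by nlinarith [sq_nonneg a]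
  have h4 : -(2 * n) ≤ c := by nlinarith [sq_nonneg a]
  interval_cases n <;> push_cast at * <;> interval_cases a <;> first
    | decide
    | (exfalso; interval_cases c <;> omega)

lemma int_dvd_of_three_mul_sq_add_sq {n : ℕ} (hn0 : 0 < n) (hn : n < 7) {a c : ℤ}
    (h : 12 * (n : ℤ) ^ 2 = 3 * a ^ 2 + c ^ 2) : (n : ℤ) ∣ a := by
  obtain ⟨b, rfl⟩ : (3 : ℤ) ∣ c :=
    Int.prime_three.dvd_of_dvd_pow (n := 2) ⟨4 * (n : ℤ) ^ 2 - a ^ 2, by linarith⟩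
  have h1 : a ≤ 2 * n := by nlinarith [sq_nonneg b]
  have h2 : -(2 * n) ≤ a := by nlinarith [sq_nonneg b]
  have h3 : b ≤ 2 * n := by nlinarith [sq_nonneg a]
  have h4 : -(2 * n) ≤ b := by nlinarith [sq_nonneg a]
  interval_cases n <;> push_cast at * <;> interval_cases a <;> first
    | decide
    | (exfalso; interval_cases b <;> omega)

section

variable {K : Type*} [Field K] [NumberField K] {σ : K ≃ₐ[ℚ] K}

/-- Norm and trace of a quadratic field in terms of its nontrivial automorphism. -/
lemma algebraMap_norm_and_trace_of_finrank_eq_two (hrank : Module.finrank ℚ K = 2)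
    (hσ : σ ≠ 1) (x : K) :
    algebraMap ℚ K (Algebra.norm ℚ x) = x * σ x ∧
      algebraMap ℚ K (Algebra.trace ℚ K x) = x + σ x := by
  classical
  have : Algebra.IsQuadraticExtension ℚ K := ⟨hrank⟩
  have hcard : Fintype.card (K ≃ₐ[ℚ] K) = 2 := by
    rw [← Nat.card_eq_fintype_card, IsGalois.card_aut_eq_finrank, hrank]
  have huniv : (Finset.univ : Finset (K ≃ₐ[ℚ] K)) = {1, σ} := by
    symm
    apply Finset.eq_univ_of_card
    rw [hcard, Finset.card_pair hσ.symm]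
  rw [Algebra.norm_eq_prod_automorphisms, trace_eq_sum_automorphisms, huniv,
    Finset.prod_pair hσ.symm, Finset.sum_pair hσ.symm]
  simp

/-- A rational number that is an algebraic integer in `K` is an integer. -/
lemma exists_int_of_isIntegral_algebraMap {q : ℚ} (h : IsIntegral ℤ (algebraMap ℚ K q)) :
    ∃ n : ℤ, q = n := by
  rw [isIntegral_algebraMap_iff (algebraMap ℚ K).injective] at h
  obtain ⟨n, hn⟩ := IsIntegrallyClosed.isIntegral_iff.1 h
  exact ⟨n, by simpa using hn.symm⟩

lemma mem_zIdeal {z : K} {x : 𝓞 K} :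
    x ∈ zIdeal K z ↔ ∃ y : 𝓞 K, (y : K) = x * z := by
  refine ⟨fun h ↦ ⟨⟨_, h⟩, rfl⟩, fun ⟨y, hy⟩ ↦ ?_⟩
  change IsIntegral ℤ ((x : K) * z)
  rw [← hy]
  exact RingOfIntegers.isIntegral_coe y

lemma zIdeal_ne_bot (z : K) : zIdeal K z ≠ ⊥ := by
  obtain ⟨a, b, hb, rfl⟩ := IsFractionRing.div_surjective (A := 𝓞 K) z
  have hb0 : (b : K) ≠ 0 := by simpa using nonZeroDivisors.ne_zero hb
  intro h
  have hmem : b ∈ zIdeal K ((a : K) / b) := mem_zIdeal.2 ⟨a, by field_simp⟩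
  rw [h, Ideal.mem_bot] at hmem
  exact nonZeroDivisors.ne_zero hb hmem

lemma zIdeal_eq_top_iff {z : K} : zIdeal K z = ⊤ ↔ IsIntegral ℤ z := by
  rw [Ideal.eq_top_iff_one]
  change IsIntegral ℤ (((1 : 𝓞 K) : K) * z) ↔ _
  simp

lemma card_quotient_zIdeal (z : K) :
    Nat.card (𝓞 K ⧸ zIdeal K z) = Ideal.absNorm (zIdeal K z) := by
  rw [Ideal.absNorm_apply, Submodule.cardQuot_apply]

lemma coe_galRestrict (x : 𝓞 K) :
    ((galRestrict ℤ ℚ K (𝓞 K) σ x : 𝓞 K) : K) = σ x :=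
  algebraMap_galRestrict_apply ℤ σ x

lemma absNorm_map_galRestrict (I : Ideal (𝓞 K)) :
    Ideal.absNorm (I.map (galRestrict ℤ ℚ K (𝓞 K) σ)) = Ideal.absNorm I := by
  rw [← Ideal.absNorm_relNorm ℤ, Ideal.relNorm_map_algEquiv, Ideal.absNorm_relNorm]

/-- In a quadratic field the product of an ideal and its conjugate is generated by the
absolute norm. -/
lemma mul_map_galRestrict_eq_span_absNorm
    (hnorm : ∀ x : K, algebraMap ℚ K (Algebra.norm ℚ x) = x * σ x)
    (hrank : Module.finrank ℚ K = 2) (I : Ideal (𝓞 K)) :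
    I * I.map (galRestrict ℤ ℚ K (𝓞 K) σ) = Ideal.span {(Ideal.absNorm I : 𝓞 K)} := by
  rcases eq_or_ne I ⊥ with rfl | hI
  · simp
  have hle : Ideal.span {(Ideal.absNorm I : 𝓞 K)} ≤
      I * I.map (galRestrict ℤ ℚ K (𝓞 K) σ) := by
    have hcomap : Ideal.relNorm ℤ I ≤
        (I * I.map (galRestrict ℤ ℚ K (𝓞 K) σ)).comap (algebraMap ℤ (𝓞 K)) := by
      rw [Ideal.relNorm_apply, Ideal.span_le]
      rintro _ ⟨x, hx, rfl⟩
      have hx' : algebraMap ℤ (𝓞 K) (Algebra.intNorm ℤ (𝓞 K) x) =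
          x * galRestrict ℤ ℚ K (𝓞 K) σ x := by
        apply RingOfIntegers.coe_injective
        rw [map_mul, algebraMap_galRestrict_apply, ← hnorm, Algebra.intNorm_eq_norm]
        rw [← Algebra.coe_norm_int]
        simp
      simp only [SetLike.mem_coe, Ideal.mem_comap]
      rw [hx']
      exact Ideal.mul_mem_mul hx (Ideal.mem_map_of_mem _ hx)
    rw [Ideal.relNorm_int, Ideal.span_singleton_le_iff_mem, Ideal.mem_comap] at hcomap
    rw [Ideal.span_singleton_le_iff_mem]
    simpa using hcomap
  obtain ⟨J, hJ⟩ := Ideal.dvd_iff_le.2 hle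
  have hN : Ideal.absNorm I ≠ 0 := Ideal.absNorm_eq_zero_iff.not.2 hI
  have hJ1 : Ideal.absNorm J = 1 := by
    have h := congrArg Ideal.absNorm hJ
    rw [map_mul, map_mul, absNorm_map_galRestrict, Ideal.absNorm_span_natCast,
      RingOfIntegers.rank, hrank, sq] at h
    exact (mul_eq_left₀ (mul_ne_zero hN hN)).1 h.symm
  rw [hJ, Ideal.absNorm_eq_one_iff.1 hJ1, Ideal.mul_top]

variable {z : K}

lemma mem_map_galRestrict_zIdeal (hσσ : ∀ x, σ (σ x) = x) (hz : z * σ z = 1) {y : 𝓞 K} :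
    y ∈ (zIdeal K z).map (galRestrict ℤ ℚ K (𝓞 K) σ) ↔
      ∃ x ∈ zIdeal K z, (y : K) = x * z := by
  have key (x : 𝓞 K) (hx : x ∈ zIdeal K z) (w : 𝓞 K) (hw : (w : K) = x * z) :
      galRestrict ℤ ℚ K (𝓞 K) σ w ∈ zIdeal K z ∧
        ((galRestrict ℤ ℚ K (𝓞 K) σ w : 𝓞 K) : K) * z =
          (galRestrict ℤ ℚ K (𝓞 K) σ x : 𝓞 K) := by
    have h : ((galRestrict ℤ ℚ K (𝓞 K) σ w : 𝓞 K) : K) * z =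
        (galRestrict ℤ ℚ K (𝓞 K) σ x : 𝓞 K) := by
      rw [coe_galRestrict, coe_galRestrict, hw, map_mul, mul_assoc, mul_comm (σ z), hz, mul_one]
    exact ⟨mem_zIdeal.2 ⟨_, h.symm⟩, h⟩
  have hinv (x : 𝓞 K) :
      galRestrict ℤ ℚ K (𝓞 K) σ (galRestrict ℤ ℚ K (𝓞 K) σ x) = x := by
    apply RingOfIntegers.coe_injective
    rw [algebraMap_galRestrict_apply, algebraMap_galRestrict_apply, hσσ]
  rw [Ideal.mem_map_of_equiv]
  constructor
  · rintro ⟨x, hx, rfl⟩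
    obtain ⟨w, hw⟩ := mem_zIdeal.1 hx
    exact ⟨_, (key x hx w hw).1, (key x hx w hw).2.symm⟩
  · rintro ⟨x, hx, hy⟩
    exact ⟨_, (key x hx y hy).1, hinv y⟩

/-- The ideal `π_z` of a norm-one element is coprime to its conjugate and its square is
principal. -/
lemma zIdeal_sup_map_eq_top_and_isPrincipal_sq
    (hnorm : ∀ x : K, algebraMap ℚ K (Algebra.norm ℚ x) = x * σ x)
    (hrank : Module.finrank ℚ K = 2) (hσσ : ∀ x, σ (σ x) = x) (hz : z * σ z = 1) :
    zIdeal K z ⊔ (zIdeal K z).map (galRestrict ℤ ℚ K (𝓞 K) σ) = ⊤ ∧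
      Submodule.IsPrincipal (zIdeal K z ^ 2 : Ideal (𝓞 K)) := by
  obtain ⟨a, b, hb, hab⟩ := IsFractionRing.div_surjective (A := 𝓞 K) z
  have hb0 : b ≠ 0 := nonZeroDivisors.ne_zero hb
  have hbK : (b : K) ≠ 0 := by simpa using hb0
  have hz0 : z ≠ 0 := left_ne_zero_of_mul_eq_one hz
  have hbz : (b : K) * z = a := by rw [← hab]; field_simp
  have ha0 : a ≠ 0 := by
    rintro rfl
    simp [hbK, hz0] at hbz
  set I := zIdeal K z with hI
  set I' := I.map (galRestrict ℤ ℚ K (𝓞 K) σ) with hI'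
  have hmul : Ideal.span {a} * I = Ideal.span {b} * I' := by
    ext t
    simp only [Ideal.mem_span_singleton_mul]
    constructor
    · rintro ⟨x, hx, rfl⟩
      obtain ⟨y, hy⟩ := mem_zIdeal.1 hx
      refine ⟨y, (mem_map_galRestrict_zIdeal hσσ hz).2 ⟨x, hx, hy⟩, ?_⟩
      apply RingOfIntegers.coe_injective
      rw [map_mul, map_mul]
      linear_combination (b : K) * hy + (x : K) * hbz
    · rintro ⟨y, hy, rfl⟩
      obtain ⟨x, hx, hxy⟩ := (mem_map_galRestrict_zIdeal hσσ hz).1 hy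
      refine ⟨x, hx, ?_⟩
      apply RingOfIntegers.coe_injective
      rw [map_mul, map_mul]
      linear_combination -(b : K) * hxy - (x : K) * hbz
  constructor
  · obtain ⟨C, hC⟩ : Ideal.span {a} ⊔ Ideal.span {b} ∣ Ideal.span {b} :=
      Ideal.dvd_iff_le.2 le_sup_right
    have hCI : C ≤ I := by
      intro x hx
      have hmem : a * x ∈ Ideal.span {b} := by
        rw [hC]
        exact Ideal.mul_mem_mul (Ideal.mem_sup_left (Ideal.mem_span_singleton_self a)) hx
      obtain ⟨y, hy⟩ := Ideal.mem_span_singleton'.1 hmem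
      refine mem_zIdeal.2 ⟨y, mul_left_cancel₀ hbK ?_⟩
      have h := congrArg (algebraMap (𝓞 K) K) hy
      rw [map_mul, map_mul] at h
      linear_combination h - (x : K) * hbz
    have hle : Ideal.span {b} * ⊤ ≤ Ideal.span {b} * (I ⊔ I') := by
      rw [Ideal.mul_top, Ideal.mul_sup, ← hmul, sup_comm, ← Ideal.sup_mul]
      nth_rewrite 1 [hC]
      exact Ideal.mul_mono_right hCI
    exact top_le_iff.1 ((Ideal.span_singleton_mul_right_mono hb0).1 hle)
  · have h1 := mul_map_galRestrict_eq_span_absNorm hnorm hrank I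
    have h2 : Ideal.span {a} * I ^ 2 = Ideal.span {b * (Ideal.absNorm I : 𝓞 K)} := by
      rw [← Ideal.span_singleton_mul_span_singleton, ← h1, sq, ← mul_assoc, hmul]
      ring
    obtain ⟨w, -, hw⟩ := Ideal.mem_span_singleton_mul.1
      (h2 ▸ Ideal.mem_span_singleton_self (b * (Ideal.absNorm I : 𝓞 K)))
    rw [← hw, ← Ideal.span_singleton_mul_span_singleton] at h2
    exact ⟨w, (Ideal.span_singleton_mul_right_inj ha0).1 h2⟩

/-- If `π² = (w)` with `π` coprime to its conjugate, then `π` is the ideal of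
`N(π) / w`. -/
lemma zIdeal_absNorm_div_eq
    (hnorm : ∀ x : K, algebraMap ℚ K (Algebra.norm ℚ x) = x * σ x)
    (hrank : Module.finrank ℚ K = 2) {I : Ideal (𝓞 K)} (hI : I ≠ ⊥)
    (hcop : I ⊔ I.map (galRestrict ℤ ℚ K (𝓞 K) σ) = ⊤) {w : 𝓞 K}
    (hw : I ^ 2 = Ideal.span {w}) :
    zIdeal K ((Ideal.absNorm I : K) / w) = I := by
  have hw0 : w ≠ 0 := by
    rintro rfl
    rw [Ideal.span_singleton_zero] at hw
    exact hI (pow_eq_zero_iff two_ne_zero |>.1 hw)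
  have hwK : (w : K) ≠ 0 := by simpa using hw0
  have h1 := mul_map_galRestrict_eq_span_absNorm hnorm hrank I
  set I' := I.map (galRestrict ℤ ℚ K (𝓞 K) σ)
  have hmem (x : 𝓞 K) : x ∈ zIdeal K ((Ideal.absNorm I : K) / w) ↔
      ∃ y : 𝓞 K, w * y = (Ideal.absNorm I : 𝓞 K) * x := by
    rw [mem_zIdeal]
    refine exists_congr fun y ↦ ?_
    rw [← RingOfIntegers.coe_injective.eq_iff, map_mul, map_mul, map_natCast]
    field_simp
  ext x
  rw [hmem]
  constructor
  · rintro ⟨y, hy⟩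
    have h2 : I * (Ideal.span {x} * I') = I * (Ideal.span {y} * I) := by
      have h3 : Ideal.span {w} * Ideal.span {y} =
          Ideal.span {(Ideal.absNorm I : 𝓞 K)} * Ideal.span {x} := by
        rw [Ideal.span_singleton_mul_span_singleton, Ideal.span_singleton_mul_span_singleton, hy]
      rw [← hw, ← h1] at h3
      calc I * (Ideal.span {x} * I') = I * I' * Ideal.span {x} := by ring
        _ = I ^ 2 * Ideal.span {y} := h3.symm
        _ = I * (Ideal.span {y} * I) := by ring
    have h4 := mul_left_cancel₀ hI h2
    have h5 : Ideal.span {x} * (I ⊔ I') ≤ I := by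
      rw [Ideal.mul_sup, h4]
      exact sup_le Ideal.mul_le_right Ideal.mul_le_right
    rwa [hcop, Ideal.mul_top, Ideal.span_singleton_le_iff_mem] at h5
  · intro hx
    have h2 : (Ideal.absNorm I : 𝓞 K) * x ∈ Ideal.span {w} * I' := by
      rw [← hw, sq, mul_assoc, h1, mul_comm I]
      exact Ideal.mul_mem_mul (Ideal.mem_span_singleton_self _) hx
    obtain ⟨y, -, hy⟩ := Ideal.mem_span_singleton_mul.1 h2
    exact ⟨y, hy⟩

lemma norm_trace_identity {d : ℕ} {sqd : K} (hsq : sqd * sqd = -(d : K))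
    (hσ : σ sqd = -sqd)
    (hnorm : ∀ x : K, algebraMap ℚ K (Algebra.norm ℚ x) = x * σ x)
    (htrace : ∀ x : K, algebraMap ℚ K (Algebra.trace ℚ K x) = x + σ x) (x : K) :
    4 * d * Algebra.norm ℚ x =
      d * Algebra.trace ℚ K x ^ 2 + Algebra.trace ℚ K (x * sqd) ^ 2 := by
  apply (algebraMap ℚ K).injective
  simp only [map_mul, map_add, map_pow, hnorm, htrace, hσ, map_natCast, map_ofNat]
  linear_combination -(x - σ x) ^ 2 * hsq

lemma absNorm_div_mul_conj_eq_one {d : ℕ} (hd : 0 < d)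
    (hnorm : ∀ x : K, algebraMap ℚ K (Algebra.norm ℚ x) = x * σ x)
    (htrace : ∀ x : K, algebraMap ℚ K (Algebra.trace ℚ K x) = x + σ x)
    {sqd : K} (hsq : sqd * sqd = -(d : K)) (hσ : σ sqd = -sqd)
    {I : Ideal (𝓞 K)} (hI : I ≠ ⊥) {w : 𝓞 K} (hw : I ^ 2 = Ideal.span {w}) :
    (Ideal.absNorm I : K) / w * σ ((Ideal.absNorm I : K) / w) = 1 := by
  have hN : Algebra.norm ℚ (w : K) = (Ideal.absNorm I : ℚ) ^ 2 := by
    have habs : |Algebra.norm ℚ (w : K)| = (Ideal.absNorm I : ℚ) ^ 2 := by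
      have h := congrArg Ideal.absNorm hw
      rw [map_pow, Ideal.absNorm_span_singleton] at h
      rw [← Algebra.coe_norm_int, ← Int.cast_abs, Int.abs_eq_natAbs, ← h]
      push_cast
      rfl
    rw [← habs, abs_of_nonneg]
    have hid := norm_trace_identity hsq hσ hnorm htrace (w : K)
    have hdQ : (0 : ℚ) < d := by exact_mod_cast hd
    have hpos : 0 ≤ 4 * d * Algebra.norm ℚ (w : K) := by
      rw [hid]
      positivity
    exact nonneg_of_mul_nonneg_right hpos (by positivity)
  have hw' := hnorm w
  rw [hN, map_pow, map_natCast] at hw'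
  have hI0 : (Ideal.absNorm I : K) ≠ 0 := by
    exact_mod_cast Ideal.absNorm_eq_zero_iff.not.2 hI
  rw [map_div₀, map_natCast, div_mul_div_comm, ← hw', ← sq]
  exact div_self (pow_ne_zero 2 hI0)

/-- In an imaginary quadratic field a norm-one element is a root of unity as soon as its trace
is an integer. -/
lemma exists_pow_eq_one_of_trace_eq_intCast {d : ℕ} (hd : 0 < d)
    (hnorm : ∀ x : K, algebraMap ℚ K (Algebra.norm ℚ x) = x * σ x)
    (htrace : ∀ x : K, algebraMap ℚ K (Algebra.trace ℚ K x) = x + σ x)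
    {sqd : K} (hsq : sqd * sqd = -(d : K)) (hσ : σ sqd = -sqd)
    (hz : z * σ z = 1) {t : ℤ} (ht : Algebra.trace ℚ K z = t) :
    ∃ k : ℕ, 0 < k ∧ z ^ k = 1 := by
  have hN : Algebra.norm ℚ z = 1 := by
    apply (algebraMap ℚ K).injective
    rw [hnorm, hz, map_one]
  have hid := norm_trace_identity hsq hσ hnorm htrace z
  rw [hN, ht] at hid
  have hdQ : (0 : ℚ) < d := by exact_mod_cast hd
  have ht4 : (t : ℚ) ^ 2 ≤ 4 := by
    by_contra! h
    nlinarith [sq_nonneg (Algebra.trace ℚ K (z * sqd))]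
  refine exists_pow_eq_one_of_sq_le_four (t := t) (by exact_mod_cast ht4) ?_
  have h := htrace z
  rw [ht, map_intCast] at h
  rw [h]
  linear_combination -hz

lemma exists_int_trace_eq
    (htrace : ∀ x : K, algebraMap ℚ K (Algebra.trace ℚ K x) = x + σ x)
    {x : K} (hx : IsIntegral ℤ x) : ∃ n : ℤ, Algebra.trace ℚ K x = n := by
  apply exists_int_of_isIntegral_algebraMap (K := K)
  rw [htrace]
  exact hx.add (hx.map (σ.toAlgHom.restrictScalars ℤ))

/-- If the integral solutions of `4dn² = da² + c²` with `0 < n < 4 + d` all satisfy `n ∣ a`, and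
`(2 + √-d) / (2 - √-d)` is not an algebraic integer, then the minimum `F(d)` is `4 + d`. -/
lemma Fquad_eq_four_add {d : ℕ} (hd : 0 < d)
    (hnorm : ∀ x : K, algebraMap ℚ K (Algebra.norm ℚ x) = x * σ x)
    (htrace : ∀ x : K, algebraMap ℚ K (Algebra.trace ℚ K x) = x + σ x)
    {sqd : K} (hsq : sqd * sqd = -(d : K)) (hσ : σ sqd = -sqd)
    (hdvd : ∀ (n : ℕ) (a c : ℤ), 0 < n → n < 4 + d →
      4 * d * (n : ℤ) ^ 2 = d * a ^ 2 + c ^ 2 → (n : ℤ) ∣ a)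
    (hint : ∀ m : ℤ, (4 + d : ℤ) * m ≠ 2 * (4 - d)) :
    Fquad K σ = 4 + d := by
  have hsqd : IsIntegral ℤ sqd := by
    apply IsIntegral.of_pow (n := 2) two_pos
    rw [sq, hsq]
    exact (isIntegral_natCast d).neg
  have h2 : IsIntegral ℤ (2 : K) := by exact_mod_cast isIntegral_natCast (R := ℤ) (B := K) 2
  have hd4 : (4 + d : K) ≠ 0 := by
    have h : ((4 + d : ℕ) : K) ≠ 0 := Nat.cast_ne_zero.2 (by omega)
    simpa using h
  have hprod : (2 - sqd) * (2 + sqd) = 4 + d := by linear_combination -hsq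
  have hsub : 2 - sqd ≠ 0 := left_ne_zero_of_mul (hprod ▸ hd4)
  have hadd : 2 + sqd ≠ 0 := right_ne_zero_of_mul (hprod ▸ hd4)
  obtain ⟨u, hu⟩ : ∃ u : 𝓞 K, (u : K) = 2 - sqd := ⟨⟨_, h2.sub hsqd⟩, rfl⟩
  obtain ⟨v, hv⟩ : ∃ v : 𝓞 K, (v : K) = 2 + sqd := ⟨⟨_, h2.add hsqd⟩, rfl⟩
  have hσz : σ ((2 + sqd) / (2 - sqd)) = (2 - sqd) / (2 + sqd) := by
    rw [map_div₀, map_add, map_sub, hσ, map_ofNat]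
    ring
  have hmem : ∃ m ≤ 4 + d, ∃ z : K, z * σ z = 1 ∧ (¬ ∃ k : ℕ, 0 < k ∧ z ^ k = 1) ∧
      m = Nat.card ((𝓞 K) ⧸ zIdeal K z) := by
    refine ⟨_, ?_, (2 + sqd) / (2 - sqd), ?_, ?_, rfl⟩
    · have hle : Ideal.span {u} ≤ zIdeal K ((2 + sqd) / (2 - sqd)) := by
        rw [Ideal.span_singleton_le_iff_mem, mem_zIdeal]
        exact ⟨v, by rw [hu, hv]; field_simp⟩
      have hN : Algebra.norm ℤ u = 4 + d := by
        have h : Algebra.norm ℚ (u : K) = 4 + d := by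
          apply (algebraMap ℚ K).injective
          rw [hnorm, hu, map_sub, hσ, map_ofNat, sub_neg_eq_add, hprod]
          simp
        rw [← Algebra.coe_norm_int] at h
        exact_mod_cast h
      have hdiv := Ideal.absNorm_dvd_absNorm_of_le hle
      rw [Ideal.absNorm_span_singleton, hN, ← card_quotient_zIdeal] at hdiv
      exact Nat.le_of_dvd (by omega) (by exact_mod_cast hdiv)
    · rw [hσz]
      field_simp
    · rintro ⟨k, hk, hk1⟩
      obtain ⟨m, hm⟩ := exists_int_trace_eq htrace (isIntegral_of_pow_eq_one hk hk1)
      apply hint m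
      have h := htrace ((2 + sqd) / (2 - sqd))
      rw [hm, hσz, map_intCast] at h
      have h' : (4 + d : K) * m = 2 * (4 - d) := by
        rw [h, ← hprod]
        field_simp
        linear_combination 2 * hsq
      exact_mod_cast h'
  obtain ⟨m, hm4, hm⟩ := hmem
  refine le_antisymm ((Nat.sInf_le hm).trans hm4) ?_
  have hne : {m : ℕ | ∃ z : K, z * σ z = 1 ∧ (¬ ∃ k : ℕ, 0 < k ∧ z ^ k = 1) ∧
      m = Nat.card ((𝓞 K) ⧸ zIdeal K z)}.Nonempty := ⟨m, hm⟩
  obtain ⟨z, hz, hroot, hn⟩ := Nat.sInf_mem hne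
  change Fquad K σ = _ at hn
  rw [hn]
  by_contra! hlt
  apply hroot
  rw [card_quotient_zIdeal] at hlt
  set n := Ideal.absNorm (zIdeal K z) with hndef
  have hn0 : 0 < n := Nat.pos_of_ne_zero (Ideal.absNorm_eq_zero_iff.not.2 (zIdeal_ne_bot z))
  obtain ⟨y, hy⟩ := mem_zIdeal.1 (Ideal.absNorm_mem (zIdeal K z))
  rw [← hndef, RingOfIntegers.coe_eq_algebraMap (n : 𝓞 K), map_natCast] at hy
  obtain ⟨a, ha⟩ := exists_int_trace_eq htrace (RingOfIntegers.isIntegral_coe y)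
  obtain ⟨c, hc⟩ := exists_int_trace_eq htrace ((RingOfIntegers.isIntegral_coe y).mul hsqd)
  have hN : Algebra.norm ℚ (y : K) = n ^ 2 := by
    apply (algebraMap ℚ K).injective
    rw [hnorm, hy, map_mul, map_natCast, map_pow, map_natCast]
    linear_combination (n : K) ^ 2 * hz
  have hid := norm_trace_identity hsq hσ hnorm htrace (y : K)
  rw [hN, ha, hc] at hid
  obtain ⟨t, rfl⟩ := hdvd n a c hn0 hlt (by exact_mod_cast hid)
  refine exists_pow_eq_one_of_trace_eq_intCast hd hnorm htrace hsq hσ hz (t := t) ?_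
  have hnK : (n : K) ≠ 0 := by exact_mod_cast hn0.ne'
  apply (algebraMap ℚ K).injective
  have h := htrace y
  rw [ha, hy, map_mul, map_natCast, map_intCast] at h
  push_cast at h
  rw [htrace, map_intCast]
  apply mul_left_cancel₀ hnK
  linear_combination -h

end

/-- Let `d` be a positive square-free integer, `K = ℚ(√-d)` (with
`σ` the complex conjugation, i.e. the nontrivial element of `Gal(K/ℚ)`), and `𝒥` the
set of nonzero proper ideals `π` of `𝒪_K` with `π` coprime to `π̄` and `π²` principal.
Then `F(d) = min_{π ∈ 𝒥} N(π)`; in particular `F(1) = 5` and `F(3) = 7`. -/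
theorem Fquad_eq_min_absNorm
    (d : ℕ) (hd : Squarefree d) (hdpos : 0 < d)
    (K : Type*) [Field K] [NumberField K]
    (hrank : Module.finrank ℚ K = 2)
    (sqd : K) (hsq : sqd * sqd = -(d : K))
    (σ : K ≃ₐ[ℚ] K) (hσ : σ sqd = -sqd) :
    Fquad K σ = sInf {m : ℕ | ∃ π : Ideal (𝓞 K), π ≠ ⊥ ∧ π ≠ ⊤ ∧
        π ⊔ Ideal.map (galRestrict ℤ ℚ K (𝓞 K) σ) π = ⊤ ∧
        Submodule.IsPrincipal (π ^ 2 : Ideal (𝓞 K)) ∧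
        m = Ideal.absNorm π} ∧
      (d = 1 → Fquad K σ = 5) ∧ (d = 3 → Fquad K σ = 7) := by
  have hdK : (d : K) ≠ 0 := by exact_mod_cast hdpos.ne'
  have hsqd0 : sqd ≠ 0 := by
    rintro rfl
    apply hdK
    simpa using hsq
  have hσ1 : σ ≠ 1 := by
    rintro rfl
    exact hsqd0 (self_eq_neg.1 hσ)
  have hnt := algebraMap_norm_and_trace_of_finrank_eq_two hrank hσ1
  have hnorm (x : K) := (hnt x).1
  have htrace (x : K) := (hnt x).2
  have hσσ (x : K) : σ (σ x) = x := by
    have h := congrArg σ (htrace x)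
    rw [AlgEquiv.commutes, map_add, htrace] at h
    linear_combination -h
  refine ⟨?_, ?_, ?_⟩
  · unfold Fquad
    congr 1
    ext m
    constructor
    · rintro ⟨z, hz, hroot, rfl⟩
      have h := zIdeal_sup_map_eq_top_and_isPrincipal_sq hnorm hrank hσσ hz
      refine ⟨zIdeal K z, zIdeal_ne_bot z, fun htop ↦ hroot ?_, h.1, h.2,
        card_quotient_zIdeal z⟩
      obtain ⟨t, ht⟩ := exists_int_trace_eq htrace (zIdeal_eq_top_iff.1 htop)
      exact exists_pow_eq_one_of_trace_eq_intCast hdpos hnorm htrace hsq hσ hz ht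
    · rintro ⟨I, hbot, htop, hcop, ⟨w, hw⟩, rfl⟩
      rw [Ideal.submodule_span_eq] at hw
      have hI := zIdeal_absNorm_div_eq hnorm hrank hbot hcop hw
      refine ⟨(Ideal.absNorm I : K) / w, ?_, ?_, by rw [card_quotient_zIdeal, hI]⟩
      · exact absNorm_div_mul_conj_eq_one hdpos hnorm htrace hsq hσ hbot hw
      · rintro ⟨k, hk, hk1⟩
        exact htop (hI ▸ zIdeal_eq_top_iff.2 (isIntegral_of_pow_eq_one hk hk1))
  · rintro rfl
    refine Fquad_eq_four_add one_pos hnorm htrace hsq hσ (fun n a c h0 hn h ↦ ?_)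
      (fun m ↦ ?_)
    · exact int_dvd_of_sq_add_sq h0 hn (c := c) (by push_cast at h; linarith)
    · push_cast
      omega
  · rintro rfl
    refine Fquad_eq_four_add three_pos hnorm htrace hsq hσ (fun n a c h0 hn h ↦ ?_)
      (fun m ↦ ?_)
    · exact int_dvd_of_three_mul_sq_add_sq h0 hn (c := c) (by push_cast at h; linarith)
    · push_cast
      omega
end
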